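/- Let d ≥ 4 be an integer, ζ ∈ {0,1}, and if ζ = 1 assume 4 ≤ d ≤ 5 and 1 + 4/(d−1) ≤ p ≤ 1 + 4/(d−2). Let κ ∈ (0, 1/2) and let u be a classical finite-energy solution of the Coulomb wave equation ∂ₜ²u − Δₓu + u/|x| + ζ|u|^{p−1}u = 0 on ℝ^d such that ∫_{ℝ^d} |x|^κ e₋(x,0) dx < ∞. Then the weighted global Morawetz estimate ∫_0^∞ ∫_{ℝ^d} (t+|x|)^κ M(x,t) dx dt ≤ (1−2κ)^{−1} ∫_{ℝ^d} |x|^κ e₋(x,0) dx holds. -/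

import Mathlib

open MeasureTheory Filter

/-- The Laplacian of `u : ℝ^d → ℝ`, as the sum of second derivatives in the
coordinate directions. -/
noncomputable def lap {d : ℕ} (u : EuclideanSpace ℝ (Fin d) → ℝ)
    (x : EuclideanSpace ℝ (Fin d)) : ℝ :=
  ∑ i : Fin d, iteratedFDeriv ℝ 2 u x ![EuclideanSpace.single i 1, EuclideanSpace.single i 1]

/-- The radial derivative `u_r(x) = (x/|x|) · ∇u(x)`. -/
noncomputable def rderiv {d : ℕ} (u : EuclideanSpace ℝ (Fin d) → ℝ)
    (x : EuclideanSpace ℝ (Fin d)) : ℝ :=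
  @inner ℝ _ _ (‖x‖⁻¹ • x) (gradient u x)

/-- The angular part `∇̸u = ∇u - u_r · x/|x|` of the gradient. -/
noncomputable def angGrad {d : ℕ} (u : EuclideanSpace ℝ (Fin d) → ℝ)
    (x : EuclideanSpace ℝ (Fin d)) : EuclideanSpace ℝ (Fin d) :=
  gradient u x - rderiv u x • (‖x‖⁻¹ • x)

/-- `λ = (d-1)(d-3)/4`. -/
noncomputable def lam (d : ℕ) : ℝ := ((d : ℝ) - 1) * ((d : ℝ) - 3) / 4

/-- The energy density
`e = ½|∇ₓu|² + ½|∂ₜu|² + u²/(2|x|) + ζ|u|^{p+1}/(p+1)` of the Coulomb wave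
equation `∂ₜ²u - Δu + u/|x| + ζ|u|^{p-1}u = 0`. -/
noncomputable def eDen {d : ℕ} (p ζ : ℝ) (u : EuclideanSpace ℝ (Fin d) → ℝ → ℝ)
    (x : EuclideanSpace ℝ (Fin d)) (t : ℝ) : ℝ :=
  (1 / 2) * ‖gradient (fun y => u y t) x‖ ^ 2 + (1 / 2) * (deriv (u x) t) ^ 2
    + (u x t) ^ 2 / (2 * ‖x‖) + ζ * |u x t| ^ (p + 1) / (p + 1)

/-- `u` is a classical finite-energy solution of the Coulomb wave equation
`∂ₜ²u - Δu + u/|x| + ζ|u|^{p-1}u = 0` with conserved energy `E`: it is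
continuous on `ℝ^d × ℝ`, `C²` on `(ℝ^d∖{0}) × ℝ`, solves the equation away
from `x = 0`, and its total energy equals `E` at every time. -/
def IsCoulombSolution {d : ℕ} (p ζ : ℝ)
    (u : EuclideanSpace ℝ (Fin d) → ℝ → ℝ) (E : ℝ) : Prop :=
  Continuous (fun q : EuclideanSpace ℝ (Fin d) × ℝ => u q.1 q.2) ∧
  ContDiffOn ℝ 2 (fun q : EuclideanSpace ℝ (Fin d) × ℝ => u q.1 q.2)
    ({(0 : EuclideanSpace ℝ (Fin d))}ᶜ ×ˢ Set.univ) ∧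
  (∀ x : EuclideanSpace ℝ (Fin d), x ≠ 0 → ∀ t : ℝ,
    deriv (deriv (u x)) t - lap (fun y => u y t) x + u x t / ‖x‖
      + ζ * |u x t| ^ (p - 1) * u x t = 0) ∧
  (∀ t : ℝ, Integrable (fun x => eDen p ζ u x t)) ∧
  (∀ t : ℝ, ∫ x, eDen p ζ u x t = E)

/-- The non-directional energy density
`e' = ½|∇̸u|² + (λ/2)u²/|x|² + u²/(2|x|) + ζ|u|^{p+1}/(p+1)`. -/
noncomputable def ePrime {d : ℕ} (p ζ : ℝ) (u : EuclideanSpace ℝ (Fin d) → ℝ → ℝ)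
    (x : EuclideanSpace ℝ (Fin d)) (t : ℝ) : ℝ :=
  (1 / 2) * ‖angGrad (fun y => u y t) x‖ ^ 2 + lam d / 2 * (u x t) ^ 2 / ‖x‖ ^ 2
    + (u x t) ^ 2 / (2 * ‖x‖) + ζ * |u x t| ^ (p + 1) / (p + 1)

/-- `L₊u = u_r + ((d-1)/2)·u/|x| + ∂ₜu`. -/
noncomputable def Lplus {d : ℕ} (u : EuclideanSpace ℝ (Fin d) → ℝ → ℝ)
    (x : EuclideanSpace ℝ (Fin d)) (t : ℝ) : ℝ :=
  rderiv (fun y => u y t) x + ((d : ℝ) - 1) / 2 * u x t / ‖x‖ + deriv (u x) t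

/-- The inward energy density `e₋ = ¼|L₊u|² + ½e'`. -/
noncomputable def eMinus {d : ℕ} (p ζ : ℝ) (u : EuclideanSpace ℝ (Fin d) → ℝ → ℝ)
    (x : EuclideanSpace ℝ (Fin d)) (t : ℝ) : ℝ :=
  (1 / 4) * (Lplus u x t) ^ 2 + (1 / 2) * ePrime p ζ u x t

/-- The Morawetz density
`M = ½|∇̸u|²/|x| + (λ/2)u²/|x|³ + ζ(d-1)(p-1)|u|^{p+1}/(4(p+1)|x|) + u²/(4|x|²)`. -/
noncomputable def Mden {d : ℕ} (p ζ : ℝ) (u : EuclideanSpace ℝ (Fin d) → ℝ → ℝ)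
    (x : EuclideanSpace ℝ (Fin d)) (t : ℝ) : ℝ :=
  (1 / 2) * ‖angGrad (fun y => u y t) x‖ ^ 2 / ‖x‖ + lam d / 2 * (u x t) ^ 2 / ‖x‖ ^ 3
    + ζ * ((d : ℝ) - 1) * (p - 1) * |u x t| ^ (p + 1) / (4 * (p + 1) * ‖x‖)
    + (u x t) ^ 2 / (4 * ‖x‖ ^ 2)

section LineDerivatives

variable {F : Type*} [NormedAddCommGroup F] [InnerProductSpace ℝ F]

open scoped RealInnerProductSpace

/-- The first and second derivatives of a `C²` function `u` on `(F ∖ {0}) × ℝ`: `g` and `w` are the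
space gradient and the time derivative, `H`, `k`, `a` the space Hessian, the mixed derivative
`∇∂ₜu` and the second time derivative. -/
structure IsWaveJet (u w a : F × ℝ → ℝ) (g k : F × ℝ → F) (H : F × ℝ → F →L[ℝ] F) : Prop where
  contDiffAt_u : ∀ q : F × ℝ, q.1 ≠ 0 → ContDiffAt ℝ 1 u q
  contDiffAt_w : ∀ q : F × ℝ, q.1 ≠ 0 → ContDiffAt ℝ 1 w q
  contDiffAt_g : ∀ q : F × ℝ, q.1 ≠ 0 → ContDiffAt ℝ 1 g q
  fderiv_u : ∀ q : F × ℝ, q.1 ≠ 0 → ∀ v, fderiv ℝ u q v = ⟪g q, v.1⟫ + w q * v.2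
  fderiv_w : ∀ q : F × ℝ, q.1 ≠ 0 → ∀ v, fderiv ℝ w q v = ⟪k q, v.1⟫ + a q * v.2
  fderiv_g : ∀ q : F × ℝ, q.1 ≠ 0 → ∀ v, fderiv ℝ g q v = H q v.1 + v.2 • k q
  symm : ∀ q : F × ℝ, q.1 ≠ 0 → ∀ x y, ⟪H q x, y⟫ = ⟪H q y, x⟫

/-- The unit radial vector field. -/
noncomputable def radDir (x : F) : F := ‖x‖⁻¹ • x

/-- The radial component of a vector field `g`. -/
noncomputable def radPart (g : F × ℝ → F) (q : F × ℝ) : ℝ := ⟪radDir q.1, g q⟫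

/-- The density `½(|g|² - g_r²) + (l/2)u²/r² + u²/(2r) + G(u)`. -/
noncomputable def tangDen (l : ℝ) (G : ℝ → ℝ) (u : F × ℝ → ℝ) (g : F × ℝ → F) (q : F × ℝ) : ℝ :=
  1 / 2 * (‖g q‖ ^ 2 - radPart g q ^ 2) + l / 2 * u q ^ 2 / ‖q.1‖ ^ 2 + u q ^ 2 / (2 * ‖q.1‖)
    + G (u q)

/-- The outgoing derivative `g_r + c u/r + w`. -/
noncomputable def outDer (c : ℝ) (u w : F × ℝ → ℝ) (g : F × ℝ → F) (q : F × ℝ) : ℝ :=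
  radPart g q + c * u q / ‖q.1‖ + w q

/-- The weight `χ(t + r) ψ(r)`. -/
noncomputable def coneWeight (χ ψ : ℝ → ℝ) (q : F × ℝ) : ℝ := χ (q.2 + ‖q.1‖) * ψ ‖q.1‖

lemma norm_radDir {x : F} (hx : x ≠ 0) : ‖radDir x‖ = 1 := by
  rw [radDir, norm_smul, norm_inv, norm_norm, inv_mul_cancel₀ (norm_ne_zero_iff.2 hx)]

lemma inner_radDir_self {x : F} (hx : x ≠ 0) : ⟪radDir x, radDir x⟫ = 1 := by
  rw [real_inner_self_eq_norm_sq, norm_radDir hx, one_pow]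

lemma hasDerivAt_norm_line {x : F} (hx : x ≠ 0) (h : F) :
    HasDerivAt (fun ε : ℝ => ‖x + ε • h‖) ⟪radDir x, h⟫ 0 := by
  have h1 : HasDerivAt (fun ε : ℝ => x + ε • h) h 0 := by
    simpa using ((hasDerivAt_id (0 : ℝ)).smul_const h).const_add x
  have h2 := (h1.norm_sq).sqrt (by simpa using hx)
  simp only [Real.sqrt_sq (norm_nonneg _), zero_smul, add_zero] at h2
  convert h2 using 1
  have := norm_ne_zero_iff.2 hx
  rw [radDir, real_inner_smul_left]
  field_simp

lemma hasDerivAt_line {G : Type*} [NormedAddCommGroup G] [NormedSpace ℝ G] {f : F × ℝ → G}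
    {q : F × ℝ} (hf : DifferentiableAt ℝ f q) (v : F × ℝ) :
    HasDerivAt (fun ε : ℝ => f (q + ε • v)) (fderiv ℝ f q v) 0 :=
  hf.hasFDerivAt.hasLineDerivAt v

variable {u w a : F × ℝ → ℝ} {g k : F × ℝ → F} {H : F × ℝ → F →L[ℝ] F}

lemma IsWaveJet.hasDerivAt_radPart (J : IsWaveJet u w a g k H) {q : F × ℝ} (hq : q.1 ≠ 0)
    (v : F × ℝ) :
    HasDerivAt (fun ε : ℝ => radPart g (q + ε • v))
      ((⟪g q, v.1⟫ - ⟪radDir q.1, v.1⟫ * radPart g q) / ‖q.1‖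
        + ⟪radDir q.1, H q v.1⟫ + v.2 * ⟪radDir q.1, k q⟫) 0 := by
  have h1 := hasDerivAt_line ((J.contDiffAt_g q hq).differentiableAt one_ne_zero) v
  have h2 : HasDerivAt (fun ε : ℝ => q.1 + ε • v.1) v.1 0 := by
    simpa using ((hasDerivAt_id (0 : ℝ)).smul_const v.1).const_add q.1
  have hr : ‖q.1‖ ≠ 0 := norm_ne_zero_iff.2 hq
  have h3 := ((hasDerivAt_norm_line hq v.1).inv (by simpa using hr)).mul (h2.inner ℝ h1)
  rw [J.fderiv_g q hq] at h3
  have h4 : (fun ε : ℝ => radPart g (q + ε • v)) =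
      (fun ε : ℝ => ‖q.1 + ε • v.1‖)⁻¹ * fun ε : ℝ => ⟪q.1 + ε • v.1, g (q + ε • v)⟫ := by
    ext ε
    exact real_inner_smul_left _ _ _
  rw [h4]
  refine h3.congr_deriv ?_
  simp only [zero_smul, add_zero, radPart, radDir, real_inner_smul_left, inner_add_right,
    real_inner_smul_right, Pi.inv_apply, real_inner_comm (g q) v.1]
  field_simp
  ring

lemma IsWaveJet.hasDerivAt_tangDen (J : IsWaveJet u w a g k H) {q : F × ℝ} (hq : q.1 ≠ 0)
    {G : ℝ → ℝ} {G' s' : ℝ} (hG : HasDerivAt G G' (u q)) (l : ℝ) (v : F × ℝ)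
    (hs : HasDerivAt (fun ε : ℝ => radPart g (q + ε • v)) s' 0) :
    HasDerivAt (fun ε : ℝ => tangDen l G u g (q + ε • v))
      (⟪g q, H q v.1⟫ + v.2 * ⟪g q, k q⟫ - radPart g q * s'
        + (l * u q / ‖q.1‖ ^ 2 + u q / ‖q.1‖ + G') * (⟪g q, v.1⟫ + w q * v.2)
        - (l * u q ^ 2 / ‖q.1‖ ^ 3 + u q ^ 2 / (2 * ‖q.1‖ ^ 2)) * ⟪radDir q.1, v.1⟫) 0 := by
  have h1 := hasDerivAt_line ((J.contDiffAt_g q hq).differentiableAt one_ne_zero) v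
  have h2 := hasDerivAt_line ((J.contDiffAt_u q hq).differentiableAt one_ne_zero) v
  have hr : ‖q.1‖ ≠ 0 := norm_ne_zero_iff.2 hq
  have h3 := hasDerivAt_norm_line hq v.1
  rw [J.fderiv_g q hq] at h1
  rw [J.fderiv_u q hq] at h2
  have h5 : HasDerivAt G G' (u (q + (0 : ℝ) • v)) := by simpa using hG
  have h4 := ((((h1.norm_sq.sub (hs.pow 2)).const_mul (1 / 2)).add
    (((h2.pow 2).const_mul (l / 2)).div (h3.pow 2) (by simpa using hr))).add
    ((h2.pow 2).div (h3.const_mul 2) (by simpa using hr))).add (h5.comp 0 h2)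
  refine h4.congr_deriv ?_
  simp only [zero_smul, add_zero, inner_add_right, real_inner_smul_right, Pi.pow_apply]
  field_simp
  ring

lemma IsWaveJet.hasDerivAt_outDer (J : IsWaveJet u w a g k H) {q : F × ℝ} (hq : q.1 ≠ 0)
    {s' : ℝ} (c : ℝ) (v : F × ℝ)
    (hs : HasDerivAt (fun ε : ℝ => radPart g (q + ε • v)) s' 0) :
    HasDerivAt (fun ε : ℝ => outDer c u w g (q + ε • v))
      (s' + c * (⟪g q, v.1⟫ + w q * v.2) / ‖q.1‖ - c * u q * ⟪radDir q.1, v.1⟫ / ‖q.1‖ ^ 2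
        + ⟪k q, v.1⟫ + a q * v.2) 0 := by
  have h2 := hasDerivAt_line ((J.contDiffAt_u q hq).differentiableAt one_ne_zero) v
  have h1 := hasDerivAt_line ((J.contDiffAt_w q hq).differentiableAt one_ne_zero) v
  have hr : ‖q.1‖ ≠ 0 := norm_ne_zero_iff.2 hq
  have h3 := hasDerivAt_norm_line hq v.1
  rw [J.fderiv_w q hq] at h1
  rw [J.fderiv_u q hq] at h2
  have h4 := (hs.add ((h2.const_mul c).div h3 (by simpa using hr))).add h1
  refine h4.congr_deriv ?_
  simp only [zero_smul, add_zero]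
  field_simp
  ring

lemma hasDerivAt_coneWeight {q : F × ℝ} (hq : q.1 ≠ 0) {χ ψ : ℝ → ℝ} {χ' ψ' : ℝ}
    (hχ : HasDerivAt χ χ' (q.2 + ‖q.1‖)) (hψ : HasDerivAt ψ ψ' ‖q.1‖) (v : F × ℝ) :
    HasDerivAt (fun ε : ℝ => coneWeight χ ψ (q + ε • v))
      ((χ' * ψ ‖q.1‖ + χ (q.2 + ‖q.1‖) * ψ') * ⟪radDir q.1, v.1⟫ + χ' * ψ ‖q.1‖ * v.2) 0 := by
  have h3 := hasDerivAt_norm_line hq v.1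
  have h1 : HasDerivAt (fun ε : ℝ => q.2 + ε • v.2) v.2 0 := by
    simpa using ((hasDerivAt_id (0 : ℝ)).smul_const v.2).const_add q.2
  have h5 : HasDerivAt χ χ' ((q.2 + (0 : ℝ) • v.2) + ‖q.1 + (0 : ℝ) • v.1‖) := by simpa using hχ
  have h6 : HasDerivAt ψ ψ' ‖q.1 + (0 : ℝ) • v.1‖ := by simpa using hψ
  have h4 := (h5.comp 0 (h1.add h3)).mul (h6.comp 0 h3)
  refine h4.congr_deriv ?_
  simp only [zero_smul, add_zero, Function.comp, Pi.add_apply]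
  ring

/-- The energy density `φ(½X² + W)` of the weighted flux. -/
noncomputable def fluxTime (l c : ℝ) (G χ ψ : ℝ → ℝ) (u w : F × ℝ → ℝ) (g : F × ℝ → F)
    (q : F × ℝ) : ℝ :=
  coneWeight χ ψ q * (1 / 2 * outDer c u w g q ^ 2 + tangDen l G u g q)

/-- The radial coefficient `φ(W - ½X² + X g_r)` of the weighted flux. -/
noncomputable def fluxRad (l c : ℝ) (G χ ψ : ℝ → ℝ) (u w : F × ℝ → ℝ) (g : F × ℝ → F)
    (q : F × ℝ) : ℝ :=
  coneWeight χ ψ q * (tangDen l G u g q - 1 / 2 * outDer c u w g q ^ 2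
    + outDer c u w g q * radPart g q)

/-- The gradient coefficient `-φX` of the weighted flux. -/
noncomputable def fluxGrad (c : ℝ) (χ ψ : ℝ → ℝ) (u w : F × ℝ → ℝ) (g : F × ℝ → F)
    (q : F × ℝ) : ℝ :=
  -(coneWeight χ ψ q * outDer c u w g q)

/-- The Morawetz density of the Coulomb wave equation with nonlinearity `f = G'` in dimension
`2 * c + 1`. -/
noncomputable def morDen (l c : ℝ) (f G : ℝ → ℝ) (u : F × ℝ → ℝ) (g : F × ℝ → F)
    (q : F × ℝ) : ℝ :=
  1 / 2 * (‖g q‖ ^ 2 - radPart g q ^ 2) / ‖q.1‖ + l / 2 * u q ^ 2 / ‖q.1‖ ^ 3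
    + c / 2 * (u q * f (u q) - 2 * G (u q)) / ‖q.1‖ + u q ^ 2 / (4 * ‖q.1‖ ^ 2)

/-- The source term `2 M φ - 2 χ' ψ W - χ ψ' (W - ½ X²)` of the weighted flux. -/
noncomputable def fluxSource (l c : ℝ) (f G χ χ' ψ ψ' : ℝ → ℝ) (u w : F × ℝ → ℝ)
    (g : F × ℝ → F) (q : F × ℝ) : ℝ :=
  2 * morDen l c f G u g q * coneWeight χ ψ q
    - 2 * χ' (q.2 + ‖q.1‖) * ψ ‖q.1‖ * tangDen l G u g q
    - χ (q.2 + ‖q.1‖) * ψ' ‖q.1‖ * (tangDen l G u g q - 1 / 2 * outDer c u w g q ^ 2)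

lemma ContDiffAt.radPart {q : F × ℝ} (hq : q.1 ≠ 0) (hg : ContDiffAt ℝ 1 g q) :
    ContDiffAt ℝ 1 (radPart g) q := by
  have h1 : ContDiffAt ℝ 1 (fun q : F × ℝ => ‖q.1‖) q := contDiffAt_fst.norm ℝ hq
  exact ((h1.inv (norm_ne_zero_iff.2 hq)).smul contDiffAt_fst).inner ℝ hg

lemma IsWaveJet.contDiffAt_tangDen (J : IsWaveJet u w a g k H) {q : F × ℝ} (hq : q.1 ≠ 0)
    {G : ℝ → ℝ} (hG : ContDiff ℝ 1 G) (l : ℝ) : ContDiffAt ℝ 1 (tangDen l G u g) q := by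
  have h1 : ContDiffAt ℝ 1 (fun q : F × ℝ => ‖q.1‖) q := contDiffAt_fst.norm ℝ hq
  have hr : ‖q.1‖ ≠ 0 := norm_ne_zero_iff.2 hq
  have hu := J.contDiffAt_u q hq
  have hg := J.contDiffAt_g q hq
  have hs := hg.radPart hq
  exact (((contDiffAt_const.mul ((hg.norm_sq ℝ).sub (hs.pow 2))).add
    ((contDiffAt_const.mul (hu.pow 2)).div (h1.pow 2) (pow_ne_zero _ hr))).add
    ((hu.pow 2).div (contDiffAt_const.mul h1) (by simpa using hq))).add
    (hG.contDiffAt.comp q hu)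

lemma IsWaveJet.contDiffAt_outDer (J : IsWaveJet u w a g k H) {q : F × ℝ} (hq : q.1 ≠ 0)
    (c : ℝ) : ContDiffAt ℝ 1 (outDer c u w g) q := by
  have h1 : ContDiffAt ℝ 1 (fun q : F × ℝ => ‖q.1‖) q := contDiffAt_fst.norm ℝ hq
  have hr : ‖q.1‖ ≠ 0 := norm_ne_zero_iff.2 hq
  exact (((J.contDiffAt_g q hq).radPart hq).add
    ((contDiffAt_const.mul (J.contDiffAt_u q hq)).div h1 hr)).add (J.contDiffAt_w q hq)

lemma contDiffAt_coneWeight {q : F × ℝ} (hq : q.1 ≠ 0) {χ ψ : ℝ → ℝ}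
    (hχ : ContDiffAt ℝ 1 χ (q.2 + ‖q.1‖)) (hψ : ContDiffAt ℝ 1 ψ ‖q.1‖) :
    ContDiffAt ℝ 1 (coneWeight χ ψ) q := by
  have h1 : ContDiffAt ℝ 1 (fun q : F × ℝ => ‖q.1‖) q := contDiffAt_fst.norm ℝ hq
  exact (hχ.comp q (contDiffAt_snd.add h1)).mul (hψ.comp q h1)

lemma fderiv_eq_of_line {f : F × ℝ → ℝ} {q v : F × ℝ} {f' : ℝ} (hf : ContDiffAt ℝ 1 f q)
    (h : HasDerivAt (fun ε : ℝ => f (q + ε • v)) f' 0) : fderiv ℝ f q v = f' :=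
  (hasDerivAt_line (hf.differentiableAt one_ne_zero) v).unique h

/-- The pointwise divergence identity for the weighted inward energy flux. -/
lemma IsWaveJet.flux_identity (J : IsWaveJet u w a g k H) {q : F × ℝ} (hq : q.1 ≠ 0)
    {f G χ χ' ψ ψ' : ℝ → ℝ} (hG : ContDiff ℝ 1 G) (hG' : ∀ y, HasDerivAt G (f y) y)
    (hχ : ContDiffAt ℝ 1 χ (q.2 + ‖q.1‖)) (hχ' : HasDerivAt χ (χ' (q.2 + ‖q.1‖)) (q.2 + ‖q.1‖))
    (hψ : ContDiffAt ℝ 1 ψ ‖q.1‖) (hψ' : HasDerivAt ψ (ψ' ‖q.1‖) ‖q.1‖)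
    {l c L : ℝ} (hl : l = c * (c - 1)) (hL : a q - L + u q / ‖q.1‖ + f (u q) = 0) :
    fderiv ℝ (fluxTime l c G χ ψ u w g) q (0, 1)
      + (fderiv ℝ (fluxRad l c G χ ψ u w g) q (radDir q.1, 0)
        + fluxRad l c G χ ψ u w g q * (2 * c / ‖q.1‖))
      + (fderiv ℝ (fluxGrad c χ ψ u w g) q (g q, 0) + fluxGrad c χ ψ u w g q * L)
      = -fluxSource l c f G χ χ' ψ ψ' u w g q := by
  have hs := (J.contDiffAt_g q hq).radPart hq
  have hW := J.contDiffAt_tangDen hq hG l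
  have hX := J.contDiffAt_outDer hq c
  have hφ := contDiffAt_coneWeight hq hχ hψ
  have dφ := hasDerivAt_coneWeight hq hχ' hψ'
  have ds := J.hasDerivAt_radPart hq
  have dW := fun v => J.hasDerivAt_tangDen hq (hG' (u q)) l v (ds v)
  have dX := fun v => J.hasDerivAt_outDer hq c v (ds v)
  have e1 := fderiv_eq_of_line (hφ.mul ((contDiffAt_const (c := (1 / 2 : ℝ))).mul
    (hX.pow 2) |>.add hW)) ((dφ (0, 1)).mul ((((dX (0, 1)).pow 2).const_mul (1 / 2)).add
      (dW (0, 1))))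
  have e2 := fderiv_eq_of_line (hφ.mul ((hW.sub ((contDiffAt_const (c := (1 / 2 : ℝ))).mul
    (hX.pow 2))).add (hX.mul hs))) ((dφ (radDir q.1, 0)).mul (((dW (radDir q.1, 0)).sub
      (((dX (radDir q.1, 0)).pow 2).const_mul (1 / 2))).add
        ((dX (radDir q.1, 0)).mul (ds (radDir q.1, 0)))))
  have e3 := fderiv_eq_of_line (hφ.mul hX).neg ((dφ (g q, 0)).mul (dX (g q, 0))).neg
  have e1' : fderiv ℝ (fluxTime l c G χ ψ u w g) q (0, 1) = _ := e1
  have e2' : fderiv ℝ (fluxRad l c G χ ψ u w g) q (radDir q.1, 0) = _ := e2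
  have e3' : fderiv ℝ (fluxGrad c χ ψ u w g) q (g q, 0) = _ := e3
  rw [e1', e2', e3']
  have hr : ‖q.1‖ ≠ 0 := norm_ne_zero_iff.2 hq
  have hsym : ⟪radDir q.1, H q (g q)⟫ = ⟪g q, H q (radDir q.1)⟫ := by
    rw [real_inner_comm, J.symm q hq, real_inner_comm]
  have hLL : L = a q + u q / ‖q.1‖ + f (u q) := by linarith
  have hgr : ⟪g q, radDir q.1⟫ = radPart g q := real_inner_comm _ _
  have hgr' : ⟪radDir q.1, g q⟫ = radPart g q := rfl
  simp only [zero_smul, add_zero, Nat.add_one_sub_one, pow_one, Nat.cast_ofNat,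
    inner_zero_right, map_zero, inner_radDir_self hq, hsym, hgr, hgr', real_inner_self_eq_norm_sq,
    real_inner_comm (k q)]
  rw [hLL, hl, fluxRad, fluxGrad, fluxSource, morDen]
  simp only [coneWeight]
  generalize hWW : tangDen (c * (c - 1)) G u g q = W
  generalize hXX : outDer c u w g q = X
  rw [tangDen] at hWW
  rw [outDer] at hXX
  rw [← hWW, ← hXX]
  field_simp
  ring

end LineDerivatives

section Jet

open scoped RealInnerProductSpace Topology

variable {F : Type*} [NormedAddCommGroup F] [InnerProductSpace ℝ F]

lemma fderiv_slice_fst {G : Type*} [NormedAddCommGroup G] [NormedSpace ℝ G] {f : F × ℝ → G}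
    {q : F × ℝ} (hf : DifferentiableAt ℝ f q) :
    HasFDerivAt (fun y => f (y, q.2)) ((fderiv ℝ f q).comp (ContinuousLinearMap.inl ℝ F ℝ)) q.1 :=
  HasFDerivAt.comp q.1 (f := fun y => (y, q.2)) hf.hasFDerivAt (hasFDerivAt_prodMk_left q.1 q.2)

lemma hasDerivAt_slice_snd {G : Type*} [NormedAddCommGroup G] [NormedSpace ℝ G] {f : F × ℝ → G}
    {q : F × ℝ} (hf : DifferentiableAt ℝ f q) :
    HasDerivAt (fun t => f (q.1, t)) (fderiv ℝ f q (0, 1)) q.2 := by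
  have h := HasFDerivAt.comp q.2 (f := fun t => (q.1, t)) hf.hasFDerivAt
    (hasFDerivAt_prodMk_right q.1 q.2)
  exact h.hasDerivAt.congr_deriv (by simp)

lemma exists_isWaveJet_of_contDiffOn [CompleteSpace F] {u : F → ℝ → ℝ}
    (hu : ContDiffOn ℝ 2 (fun q : F × ℝ => u q.1 q.2) ({(0 : F)}ᶜ ×ˢ Set.univ)) :
    ∃ (a : F × ℝ → ℝ) (k : F × ℝ → F) (H : F × ℝ → F →L[ℝ] F),
      IsWaveJet (fun q => u q.1 q.2) (fun q => deriv (u q.1) q.2) a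
        (fun q => gradient (fun y => u y q.2) q.1) k H := by
  set U : F × ℝ → ℝ := fun q => u q.1 q.2 with hU
  set w : F × ℝ → ℝ := fun q => deriv (u q.1) q.2 with hw
  set g : F × ℝ → F := fun q => gradient (fun y => u y q.2) q.1 with hg
  have hopen : IsOpen (({(0 : F)}ᶜ : Set F) ×ˢ (Set.univ : Set ℝ)) :=
    isOpen_compl_singleton.prod isOpen_univ
  have hmem : ∀ q : F × ℝ, q.1 ≠ 0 → ({(0 : F)}ᶜ : Set F) ×ˢ (Set.univ : Set ℝ) ∈ 𝓝 q :=
    fun q hq => hopen.mem_nhds ⟨hq, trivial⟩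
  have hev : ∀ q : F × ℝ, q.1 ≠ 0 → ∀ᶠ q' : F × ℝ in 𝓝 q, q'.1 ≠ 0 := fun q hq =>
    Filter.mem_of_superset (hmem q hq) fun _ h => h.1
  have hU2 : ∀ q : F × ℝ, q.1 ≠ 0 → ContDiffAt ℝ 2 U q := fun q hq =>
    hu.contDiffAt (hmem q hq)
  have hUd : ∀ q : F × ℝ, q.1 ≠ 0 → DifferentiableAt ℝ U q := fun q hq =>
    (hU2 q hq).differentiableAt two_ne_zero
  have hD : ∀ q : F × ℝ, q.1 ≠ 0 → ContDiffAt ℝ 1 (fderiv ℝ U) q := fun q hq =>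
    (hU2 q hq).fderiv_right (by norm_num)
  have hgU : ∀ q : F × ℝ, q.1 ≠ 0 →
      g q = (InnerProductSpace.toDual ℝ F).symm
        ((fderiv ℝ U q).comp (ContinuousLinearMap.inl ℝ F ℝ)) := fun q hq => by
    rw [← (fderiv_slice_fst (hUd q hq)).fderiv]
    rfl
  have hwU : ∀ q : F × ℝ, q.1 ≠ 0 → w q = fderiv ℝ U q (0, 1) := fun q hq =>
    (hasDerivAt_slice_snd (hUd q hq)).deriv
  have hg1 : ∀ q : F × ℝ, q.1 ≠ 0 → ContDiffAt ℝ 1 g q := fun q hq => by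
    refine ContDiffAt.congr_of_eventuallyEq ?_ ((hev q hq).mono fun q' hq' => hgU q' hq')
    exact ((InnerProductSpace.toDual ℝ F).symm.toContinuousLinearEquiv.contDiff.contDiffAt).comp q
      ((hD q hq).clm_comp contDiffAt_const)
  have hw1 : ∀ q : F × ℝ, q.1 ≠ 0 → ContDiffAt ℝ 1 w q := fun q hq =>
    ((hD q hq).clm_apply contDiffAt_const).congr_of_eventuallyEq
      ((hev q hq).mono fun q' hq' => hwU q' hq')
  have hDd : ∀ q : F × ℝ, q.1 ≠ 0 → DifferentiableAt ℝ (fderiv ℝ U) q := fun q hq =>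
    (hD q hq).differentiableAt one_ne_zero
  have hdg : ∀ q : F × ℝ, q.1 ≠ 0 → ∀ v y,
      ⟪fderiv ℝ g q v, y⟫ = fderiv ℝ (fderiv ℝ U) q v (y, 0) := fun q hq v y => by
    have e : (fun q' => ⟪g q', y⟫) =ᶠ[𝓝 q] fun q' => fderiv ℝ U q' (y, 0) :=
      (hev q hq).mono fun q' hq' => by
        simp [hgU q' hq', InnerProductSpace.toDual_symm_apply]
    have h1 := ((hg1 q hq).differentiableAt one_ne_zero).hasFDerivAt.inner ℝ
      (hasFDerivAt_const y q)
    have h2 := (hDd q hq).hasFDerivAt.clm_apply (hasFDerivAt_const (y, (0 : ℝ)) q)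
    have h3 := congrArg (fun L => L v) ((h2.congr_of_eventuallyEq e).unique h1)
    simpa using h3.symm
  have hdw : ∀ q : F × ℝ, q.1 ≠ 0 → ∀ v,
      fderiv ℝ w q v = fderiv ℝ (fderiv ℝ U) q v (0, 1) := fun q hq v => by
    have e : w =ᶠ[𝓝 q] fun q' => fderiv ℝ U q' (0, 1) :=
      (hev q hq).mono fun q' hq' => hwU q' hq'
    have h2 := (hDd q hq).hasFDerivAt.clm_apply (hasFDerivAt_const ((0 : F), (1 : ℝ)) q)
    rw [(h2.congr_of_eventuallyEq e).fderiv]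
    simp
  have hsymm : ∀ q : F × ℝ, q.1 ≠ 0 → ∀ v v',
      fderiv ℝ (fderiv ℝ U) q v v' = fderiv ℝ (fderiv ℝ U) q v' v := fun q hq v v' =>
    ((hU2 q hq).isSymmSndFDerivAt (by simp)) v v'
  have hsplit : ∀ v : F × ℝ, v = (v.1, 0) + v.2 • ((0 : F), (1 : ℝ)) := fun v => by
    ext <;> simp
  refine ⟨fun q => fderiv ℝ w q (0, 1), fun q => fderiv ℝ g q (0, 1),
    fun q => (fderiv ℝ g q).comp (ContinuousLinearMap.inl ℝ F ℝ),
    fun q hq => (hU2 q hq).of_le (by norm_num), hw1, hg1, fun q hq v => ?_, fun q hq v => ?_,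
    fun q hq v => ?_, fun q hq x y => ?_⟩
  · conv_lhs => rw [hsplit v]
    rw [map_add, map_smul, hwU q hq, hgU q hq, InnerProductSpace.toDual_symm_apply]
    simp [mul_comm]
  · conv_lhs => rw [hsplit v]
    rw [map_add, map_smul, hdg q hq, hdw q hq (v.1, 0), hsymm q hq (v.1, 0)]
    simp [mul_comm]
  · conv_lhs => rw [hsplit v]
    rw [map_add, map_smul]
    simp
  · simp only [ContinuousLinearMap.comp_apply, ContinuousLinearMap.inl_apply]
    rw [hdg q hq, hdg q hq, hsymm q hq]

lemma IsWaveJet.deriv_deriv [CompleteSpace F] {u : F → ℝ → ℝ} {a : F × ℝ → ℝ} {g k : F × ℝ → F}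
    {H : F × ℝ → F →L[ℝ] F}
    (J : IsWaveJet (fun q => u q.1 q.2) (fun q => deriv (u q.1) q.2) a g k H) {q : F × ℝ}
    (hq : q.1 ≠ 0) : deriv (deriv (u q.1)) q.2 = a q := by
  have h := hasDerivAt_slice_snd ((J.contDiffAt_w q hq).differentiableAt one_ne_zero)
  rw [J.fderiv_w q hq] at h
  simpa using h.deriv

lemma IsWaveJet.lap_eq {d : ℕ} {u : EuclideanSpace ℝ (Fin d) → ℝ → ℝ}
    {U w a : EuclideanSpace ℝ (Fin d) × ℝ → ℝ}
    {k : EuclideanSpace ℝ (Fin d) × ℝ → EuclideanSpace ℝ (Fin d)}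
    {H : EuclideanSpace ℝ (Fin d) × ℝ → EuclideanSpace ℝ (Fin d) →L[ℝ] EuclideanSpace ℝ (Fin d)}
    (J : IsWaveJet U w a (fun q => gradient (fun y => u y q.2) q.1) k H)
    {q : EuclideanSpace ℝ (Fin d) × ℝ} (hq : q.1 ≠ 0) :
    lap (fun y => u y q.2) q.1
      = ∑ i, ⟪H q (EuclideanSpace.single i 1), EuclideanSpace.single i 1⟫ := by
  refine Finset.sum_congr rfl fun i _ => ?_
  rw [iteratedFDeriv_two_apply]
  have h1 := fderiv_slice_fst ((J.contDiffAt_g q hq).differentiableAt one_ne_zero)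
  have h2 : fderiv ℝ (fun y => u y q.2) =
      fun y => InnerProductSpace.toDual ℝ _ (gradient (fun y => u y q.2) y) := by
    ext1 y
    simp [gradient]
  let e : EuclideanSpace ℝ (Fin d) →L[ℝ] (EuclideanSpace ℝ (Fin d) →L[ℝ] ℝ) := innerSL ℝ
  have h4 : HasFDerivAt (fderiv ℝ (fun y => u y q.2)) (e.comp ((fderiv ℝ
      (fun q : EuclideanSpace ℝ (Fin d) × ℝ => gradient (fun y => u y q.2) q.1) q).comp
        (ContinuousLinearMap.inl ℝ _ ℝ))) q.1 := by
    rw [h2]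
    exact e.hasFDerivAt.comp q.1 h1
  rw [h4.fderiv]
  simp only [e, J.fderiv_g q hq, ContinuousLinearMap.comp_apply, ContinuousLinearMap.inl_apply,
    Matrix.cons_val_zero, Matrix.cons_val_one, zero_smul, add_zero]
  rfl

end Jet

section Divergence

open scoped RealInnerProductSpace Topology

variable {d : ℕ}

lemma integral_divergence_eq_zero {Φ : EuclideanSpace ℝ (Fin d) → EuclideanSpace ℝ (Fin d)}
    (hΦ : ContDiff ℝ 1 Φ) (hc : HasCompactSupport Φ) :
    ∫ x, ∑ i, ⟪fderiv ℝ Φ x (EuclideanSpace.single i 1), EuclideanSpace.single i 1⟫ = 0 := by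
  have hd : ∀ (i : Fin d) x, fderiv ℝ (fun y => ⟪Φ y, EuclideanSpace.single i 1⟫) x
      (EuclideanSpace.single i 1)
        = ⟪fderiv ℝ Φ x (EuclideanSpace.single i 1), EuclideanSpace.single i 1⟫ := fun i x => by
    rw [(((hΦ.differentiable one_ne_zero) x).hasFDerivAt.inner ℝ (hasFDerivAt_const _ x)).fderiv]
    simp
  have hcont : ∀ i : Fin d, Continuous fun x =>
      ⟪fderiv ℝ Φ x (EuclideanSpace.single i 1), EuclideanSpace.single i (1 : ℝ)⟫ := fun i =>
    (((hΦ.continuous_fderiv one_ne_zero).clm_apply continuous_const)).inner continuous_const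
  have hsupp : ∀ i : Fin d, HasCompactSupport fun x =>
      ⟪fderiv ℝ Φ x (EuclideanSpace.single i 1), EuclideanSpace.single i (1 : ℝ)⟫ := fun i =>
    (hc.fderiv ℝ).comp_left (g := fun L : EuclideanSpace ℝ (Fin d) →L[ℝ] EuclideanSpace ℝ (Fin d)
      => ⟪L (EuclideanSpace.single i 1), EuclideanSpace.single i (1 : ℝ)⟫) (by simp)
  have hInt := fun i => (hcont i).integrable_of_hasCompactSupport (hsupp i) (μ := volume)
  rw [integral_finsetSum _ fun i _ => hInt i]
  refine Finset.sum_eq_zero fun i _ => ?_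
  have hΦi : ContDiff ℝ 1 fun y => ⟪Φ y, EuclideanSpace.single i (1 : ℝ)⟫ :=
    hΦ.inner ℝ contDiff_const
  have hΦint : Integrable fun y => ⟪Φ y, EuclideanSpace.single i (1 : ℝ)⟫ :=
    hΦi.continuous.integrable_of_hasCompactSupport
      (hc.comp_left (g := fun z => ⟪z, EuclideanSpace.single i (1 : ℝ)⟫) (by simp))
  have h := integral_mul_fderiv_eq_neg_fderiv_mul_of_integrable (𝕜 := ℝ) (μ := volume)
    (f := fun _ : EuclideanSpace ℝ (Fin d) => (1 : ℝ))
    (g := fun y => ⟪Φ y, EuclideanSpace.single i (1 : ℝ)⟫) (v := EuclideanSpace.single i 1)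
    (by simp) (by simpa [hd] using hInt i) (by simpa using hΦint)
    (fun _ _ => differentiableAt_const _) (fun x _ => hΦi.differentiable one_ne_zero x)
  simpa [hd] using h

lemma sum_inner_fderiv_radDir {x : EuclideanSpace ℝ (Fin d)} (hx : x ≠ 0) :
    ∑ i, ⟪fderiv ℝ radDir x (EuclideanSpace.single i 1), EuclideanSpace.single i (1 : ℝ)⟫
      = ((d : ℝ) - 1) / ‖x‖ := by
  have hr : ‖x‖ ≠ 0 := norm_ne_zero_iff.2 hx
  have hdiff : DifferentiableAt ℝ (radDir : EuclideanSpace ℝ (Fin d) → _) x :=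
    ((differentiableAt_id.norm ℝ hx).inv hr).smul differentiableAt_id
  have h : ∀ i : Fin d,
      ⟪fderiv ℝ radDir x (EuclideanSpace.single i 1), EuclideanSpace.single i (1 : ℝ)⟫
        = 1 / ‖x‖ - x i ^ 2 / ‖x‖ ^ 3 := fun i => by
    have h1 := hdiff.hasFDerivAt.hasLineDerivAt (EuclideanSpace.single i (1 : ℝ))
    have h2 : HasDerivAt (fun ε : ℝ => x + ε • EuclideanSpace.single i (1 : ℝ))
        (EuclideanSpace.single i (1 : ℝ)) 0 := by
      simpa using ((hasDerivAt_id (0 : ℝ)).smul_const (EuclideanSpace.single i (1 : ℝ))).const_add x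
    have h3 := ((hasDerivAt_norm_line hx (EuclideanSpace.single i (1 : ℝ))).inv
      (by simpa using hr)).smul h2
    have h4 := HasDerivAt.unique h1 h3
    rw [h4, inner_add_left, real_inner_smul_left, real_inner_smul_left, radDir,
      real_inner_smul_left]
    simp [EuclideanSpace.inner_single_right]
    field_simp
    ring
  have h5 : ∑ i, x i ^ 2 / ‖x‖ ^ 3 = ‖x‖ ^ 2 / ‖x‖ ^ 3 := by
    rw [← Finset.sum_div, ← EuclideanSpace.real_norm_sq_eq]
  rw [Finset.sum_congr rfl fun i _ => h i, Finset.sum_sub_distrib, h5]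
  simp only [Finset.sum_const, Finset.card_univ, Fintype.card_fin, nsmul_eq_mul]
  field_simp

lemma contDiff_of_eventuallyEq_zero {F G : Type*} [NormedAddCommGroup F] [NormedSpace ℝ F]
    [NormedAddCommGroup G] [NormedSpace ℝ G] {f : F → G} (h0 : f =ᶠ[𝓝 0] fun _ => 0)
    (h : ∀ x ≠ 0, ContDiffAt ℝ 1 f x) : ContDiff ℝ 1 f :=
  contDiff_iff_contDiffAt.2 fun x => by
    by_cases hx : x = 0
    · exact hx ▸ contDiffAt_const.congr_of_eventuallyEq h0
    · exact h x hx

/-- The divergence theorem for the vector field `A x/|x| + B V`. -/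
lemma integral_divergence_smul_add_smul (hd : 1 ≤ d) {A B : EuclideanSpace ℝ (Fin d) → ℝ}
    {V : EuclideanSpace ℝ (Fin d) → EuclideanSpace ℝ (Fin d)}
    (hA : ∀ x ≠ 0, ContDiffAt ℝ 1 A x) (hB : ∀ x ≠ 0, ContDiffAt ℝ 1 B x)
    (hV : ∀ x ≠ 0, ContDiffAt ℝ 1 V x) (hA0 : A =ᶠ[𝓝 0] fun _ => 0) (hB0 : B =ᶠ[𝓝 0] fun _ => 0)
    (hAc : HasCompactSupport A) (hBc : HasCompactSupport B) :
    ∫ x, ((fderiv ℝ A x (radDir x) + A x * (((d : ℝ) - 1) / ‖x‖)) + (fderiv ℝ B x (V x)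
      + B x * ∑ i, ⟪fderiv ℝ V x (EuclideanSpace.single i 1), EuclideanSpace.single i 1⟫)) = 0 := by
  have : Nonempty (Fin d) := ⟨⟨0, hd⟩⟩
  have hrad : ∀ x : EuclideanSpace ℝ (Fin d), x ≠ 0 → ContDiffAt ℝ 1 radDir x := fun x hx =>
    ((contDiffAt_id.norm ℝ hx).inv (norm_ne_zero_iff.2 hx)).smul contDiffAt_id
  have hΦ : ContDiff ℝ 1 fun x => A x • radDir x + B x • V x := by
    refine contDiff_of_eventuallyEq_zero ?_ fun x hx =>
      ((hA x hx).smul (hrad x hx)).add ((hB x hx).smul (hV x hx))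
    filter_upwards [hA0, hB0] with x h1 h2
    simp [h1, h2]
  have hc : HasCompactSupport fun x => A x • radDir x + B x • V x :=
    hAc.smul_right.add hBc.smul_right
  rw [← integral_divergence_eq_zero hΦ hc]
  refine integral_congr_ae ?_
  filter_upwards [compl_mem_ae_iff.2 (measure_singleton (0 : EuclideanSpace ℝ (Fin d)))] with x hx
  have hx : x ≠ 0 := hx
  have h1 := ((hA x hx).differentiableAt one_ne_zero).hasFDerivAt.smul
    ((hrad x hx).differentiableAt one_ne_zero).hasFDerivAt
  have h2 := ((hB x hx).differentiableAt one_ne_zero).hasFDerivAt.smul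
    ((hV x hx).differentiableAt one_ne_zero).hasFDerivAt
  have h3 : HasFDerivAt (fun x => A x • radDir x + B x • V x) _ x := h1.add h2
  have key : ∀ (f : EuclideanSpace ℝ (Fin d) →L[ℝ] ℝ) (y : EuclideanSpace ℝ (Fin d)),
      ∑ i, f (EuclideanSpace.single i 1) * y i = f y := fun f y => by
    conv_rhs => rw [← (EuclideanSpace.basisFun (Fin d) ℝ).sum_repr y]
    simp [mul_comm]
  rw [h3.fderiv, ← sum_inner_fderiv_radDir hx, ← key (fderiv ℝ A x), ← key (fderiv ℝ B x),
    Finset.mul_sum, Finset.mul_sum, ← Finset.sum_add_distrib, ← Finset.sum_add_distrib,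
    ← Finset.sum_add_distrib]
  refine Finset.sum_congr rfl fun i _ => ?_
  simp [inner_add_left, EuclideanSpace.inner_single_right]
  ring

end Divergence

section SpacetimeIdentity

open scoped RealInnerProductSpace Topology

lemma contDiffAt_one_of_hasDerivAt_Ioi {f f' : ℝ → ℝ}
    (hf : ∀ s, 0 < s → HasDerivAt f (f' s) s) (hf' : ContinuousOn f' (Set.Ioi 0)) {s : ℝ}
    (hs : 0 < s) : ContDiffAt ℝ 1 f s := by
  have h : ContDiffOn ℝ (0 + 1) f (Set.Ioi 0) := by
    rw [contDiffOn_succ_iff_deriv_of_isOpen isOpen_Ioi]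
    refine ⟨fun x hx => (hf x hx).differentiableAt.differentiableWithinAt, by simp, ?_⟩
    exact contDiffOn_zero.2 (hf'.congr fun x hx => (hf x hx).deriv)
  rw [zero_add] at h
  exact h.contDiffAt (Ioi_mem_nhds hs)

lemma integrable_prod_of_continuousOn_annulus {F : Type*} [NormedAddCommGroup F]
    [ProperSpace F] [MeasurableSpace F] [BorelSpace F] {μ : Measure F}
    [IsFiniteMeasureOnCompacts μ] [SFinite μ] {f : F × ℝ → ℝ} {α b R : ℝ} (hα : 0 < α)
    (hf : ContinuousOn f ({0}ᶜ ×ˢ Set.Icc 0 R))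
    (h1 : ∀ q : F × ℝ, q.2 ∈ Set.Icc 0 R → ‖q.1‖ ≤ α → f q = 0)
    (h2 : ∀ q : F × ℝ, q.2 ∈ Set.Icc 0 R → b ≤ ‖q.1‖ → f q = 0) :
    Integrable f (μ.prod (volume.restrict (Set.Ioc 0 R))) := by
  have hK : IsCompact ((Metric.closedBall (0 : F) b \ Metric.ball 0 α) ×ˢ Set.Icc 0 R) :=
    ((isCompact_closedBall 0 b).diff Metric.isOpen_ball).prod isCompact_Icc
  have hfK : IntegrableOn f ((Metric.closedBall (0 : F) b \ Metric.ball 0 α) ×ˢ Set.Icc 0 R)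
      (μ.prod volume) := by
    refine (hf.mono ?_).integrableOn_compact hK
    rintro ⟨x, t⟩ ⟨hx, ht⟩
    refine ⟨?_, ht⟩
    rintro rfl
    simp [hα] at hx
  have h3 : IntegrableOn f (Set.univ ×ˢ Set.Ioc 0 R) (μ.prod volume) := by
    refine hfK.of_forall_sdiff_eq_zero (MeasurableSet.univ.prod measurableSet_Ioc) ?_
    rintro ⟨x, t⟩ ⟨⟨-, ht⟩, hx⟩
    have ht' := Set.Ioc_subset_Icc_self ht
    by_cases hxα : ‖x‖ ≤ α
    · exact h1 _ ht' hxα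
    · refine h2 _ ht' ?_
      by_contra hb
      exact hx ⟨⟨by simpa using (not_le.1 hb).le, by simpa using (not_le.1 hxα).le⟩, ht'⟩
  rwa [IntegrableOn, ← Measure.prod_restrict, Measure.restrict_univ] at h3

lemma integrable_of_continuousOn_annulus {F : Type*} [NormedAddCommGroup F]
    [ProperSpace F] [MeasurableSpace F] [BorelSpace F] {μ : Measure F}
    [IsFiniteMeasureOnCompacts μ] {f : F → ℝ} {α b : ℝ} (hα : 0 < α)
    (hf : ContinuousOn f {0}ᶜ) (h1 : ∀ x, ‖x‖ ≤ α → f x = 0) (h2 : ∀ x, b ≤ ‖x‖ → f x = 0) :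
    Integrable f μ := by
  have hK : IsCompact (Metric.closedBall (0 : F) b \ Metric.ball 0 α) :=
    (isCompact_closedBall 0 b).diff Metric.isOpen_ball
  have hfK : IntegrableOn f (Metric.closedBall (0 : F) b \ Metric.ball 0 α) μ := by
    refine (hf.mono ?_).integrableOn_compact hK
    rintro x hx rfl
    simp [hα] at hx
  rw [← integrableOn_univ]
  refine hfK.of_forall_sdiff_eq_zero MeasurableSet.univ fun x hx => ?_
  by_cases hxα : ‖x‖ ≤ α
  · exact h1 _ hxα
  · refine h2 _ ?_
    by_contra hb
    exact hx.2 ⟨by simpa using (not_le.1 hb).le, by simpa using (not_le.1 hxα).le⟩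

variable {d : ℕ} {u w a : EuclideanSpace ℝ (Fin d) × ℝ → ℝ}
  {g k : EuclideanSpace ℝ (Fin d) × ℝ → EuclideanSpace ℝ (Fin d)}
  {H : EuclideanSpace ℝ (Fin d) × ℝ → EuclideanSpace ℝ (Fin d) →L[ℝ] EuclideanSpace ℝ (Fin d)}

/-- The integral identity for the weighted inward energy flux, with compactly supported cutoffs. -/
lemma IsWaveJet.integral_fluxSource (J : IsWaveJet u w a g k H) (hd : 1 ≤ d)
    {f G χ χ' ψ ψ' : ℝ → ℝ} (hG : ContDiff ℝ 1 G) (hG' : ∀ y, HasDerivAt G (f y) y)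
    (hf : Continuous f) {R α : ℝ} (hR : 0 < R) (hα : 0 < α)
    (hχ : ∀ s, 0 < s → HasDerivAt χ (χ' s) s) (hχc : ContinuousOn χ' (Set.Ioi 0))
    (hχ0 : ∀ s, R ≤ s → χ s = 0) (hχ0' : ∀ s, R ≤ s → χ' s = 0)
    (hψ : ∀ r, 0 < r → HasDerivAt ψ (ψ' r) r) (hψc : ContinuousOn ψ' (Set.Ioi 0))
    (hψ0 : ∀ r, 0 ≤ r → r ≤ α → ψ r = 0) (hψ0' : ∀ r, 0 ≤ r → r ≤ α → ψ' r = 0)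
    {l c : ℝ} (hc : 2 * c = d - 1) (hl : l = c * (c - 1))
    (heq : ∀ q : EuclideanSpace ℝ (Fin d) × ℝ, q.1 ≠ 0 →
      a q - ∑ i, ⟪H q (EuclideanSpace.single i 1), EuclideanSpace.single i 1⟫
        + u q / ‖q.1‖ + f (u q) = 0) :
    Integrable (fluxSource l c f G χ χ' ψ ψ' u w g) (volume.prod (volume.restrict (Set.Ioc 0 R)))
    ∧ Integrable (fun x => fluxTime l c G χ ψ u w g (x, 0))
    ∧ ∫ q, fluxSource l c f G χ χ' ψ ψ' u w g q ∂(volume.prod (volume.restrict (Set.Ioc 0 R)))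
      = ∫ x, fluxTime l c G χ ψ u w g (x, 0) := by
  have hne : Nonempty (Fin d) := ⟨⟨0, hd⟩⟩
  have cdχ : ∀ s, 0 < s → ContDiffAt ℝ 1 χ s := fun s hs =>
    contDiffAt_one_of_hasDerivAt_Ioi hχ hχc hs
  have cdψ : ∀ s, 0 < s → ContDiffAt ℝ 1 ψ s := fun s hs =>
    contDiffAt_one_of_hasDerivAt_Ioi hψ hψc hs
  have pos : ∀ q : EuclideanSpace ℝ (Fin d) × ℝ, q.1 ≠ 0 → 0 ≤ q.2 → 0 < q.2 + ‖q.1‖ :=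
    fun q hq ht => add_pos_of_nonneg_of_pos ht (norm_pos_iff.2 hq)
  have cφ : ∀ q : EuclideanSpace ℝ (Fin d) × ℝ, q.1 ≠ 0 → 0 ≤ q.2 →
      ContDiffAt ℝ 1 (coneWeight χ ψ) q := fun q hq ht =>
    contDiffAt_coneWeight hq (cdχ _ (pos q hq ht)) (cdψ _ (norm_pos_iff.2 hq))
  have cW := fun (q : EuclideanSpace ℝ (Fin d) × ℝ) hq => J.contDiffAt_tangDen (q := q) hq hG l
  have cX := fun (q : EuclideanSpace ℝ (Fin d) × ℝ) hq => J.contDiffAt_outDer (q := q) hq c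
  have cs := fun (q : EuclideanSpace ℝ (Fin d) × ℝ) hq => (J.contDiffAt_g q hq).radPart hq
  have cQ : ∀ q : EuclideanSpace ℝ (Fin d) × ℝ, q.1 ≠ 0 → 0 ≤ q.2 →
      ContDiffAt ℝ 1 (fluxTime l c G χ ψ u w g) q := fun q hq ht =>
    (cφ q hq ht).mul ((contDiffAt_const.mul ((cX q hq).pow 2)).add (cW q hq))
  have cA : ∀ q : EuclideanSpace ℝ (Fin d) × ℝ, q.1 ≠ 0 → 0 ≤ q.2 →
      ContDiffAt ℝ 1 (fluxRad l c G χ ψ u w g) q := fun q hq ht =>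
    (cφ q hq ht).mul (((cW q hq).sub (contDiffAt_const.mul ((cX q hq).pow 2))).add
      ((cX q hq).mul (cs q hq)))
  have cB : ∀ q : EuclideanSpace ℝ (Fin d) × ℝ, q.1 ≠ 0 → 0 ≤ q.2 →
      ContDiffAt ℝ 1 (fluxGrad c χ ψ u w g) q := fun q hq ht =>
    ((cφ q hq ht).mul (cX q hq)).neg
  have φ0 : ∀ q : EuclideanSpace ℝ (Fin d) × ℝ, ‖q.1‖ ≤ α → coneWeight χ ψ q = 0 := fun q hq => by
    rw [coneWeight, hψ0 _ (norm_nonneg _) hq, mul_zero]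
  have φR : ∀ q : EuclideanSpace ℝ (Fin d) × ℝ, R ≤ q.2 + ‖q.1‖ → coneWeight χ ψ q = 0 :=
    fun q hq => by rw [coneWeight, hχ0 _ hq, zero_mul]
  -- the source is integrable
  have hS : Integrable (fluxSource l c f G χ χ' ψ ψ' u w g)
      (volume.prod (volume.restrict (Set.Ioc 0 R))) := by
    refine integrable_prod_of_continuousOn_annulus (b := R) hα ?_ ?_ ?_
    · rintro q ⟨hq, ht⟩
      have hq : q.1 ≠ 0 := hq
      have hr : ‖q.1‖ ≠ 0 := norm_ne_zero_iff.2 hq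
      have cu := (J.contDiffAt_u q hq).continuousAt
      have cg := (J.contDiffAt_g q hq).continuousAt
      have cn : ContinuousAt (fun q : EuclideanSpace ℝ (Fin d) × ℝ => ‖q.1‖) q :=
        continuousAt_fst.norm
      have cM : ContinuousAt (morDen l c f G u g) q :=
        ((((continuousAt_const.mul ((cg.norm.pow 2).sub ((cs q hq).continuousAt.pow 2))).div
          cn hr).add ((continuousAt_const.mul (cu.pow 2)).div (cn.pow 3) (pow_ne_zero _ hr))).add
          ((continuousAt_const.mul ((cu.mul (hf.continuousAt.comp cu)).sub
            (continuousAt_const.mul (hG.continuous.continuousAt.comp cu)))).div cn hr)).add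
          ((cu.pow 2).div (continuousAt_const.mul (cn.pow 2)) (by simpa using hq))
      have c1 : ContinuousAt (fun q : EuclideanSpace ℝ (Fin d) × ℝ => χ' (q.2 + ‖q.1‖)) q :=
        ContinuousAt.comp (f := fun q : EuclideanSpace ℝ (Fin d) × ℝ => q.2 + ‖q.1‖)
          (hχc.continuousAt (Ioi_mem_nhds (pos q hq ht.1))) (continuousAt_snd.add cn)
      have c2 : ContinuousAt (fun q : EuclideanSpace ℝ (Fin d) × ℝ => χ (q.2 + ‖q.1‖)) q :=
        ContinuousAt.comp (f := fun q : EuclideanSpace ℝ (Fin d) × ℝ => q.2 + ‖q.1‖)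
          (hχ _ (pos q hq ht.1)).continuousAt (continuousAt_snd.add cn)
      have c3 : ContinuousAt (fun q : EuclideanSpace ℝ (Fin d) × ℝ => ψ' ‖q.1‖) q :=
        ContinuousAt.comp (f := fun q : EuclideanSpace ℝ (Fin d) × ℝ => ‖q.1‖)
          (hψc.continuousAt (Ioi_mem_nhds (norm_pos_iff.2 hq))) cn
      have c4 : ContinuousAt (fun q : EuclideanSpace ℝ (Fin d) × ℝ => ψ ‖q.1‖) q :=
        ContinuousAt.comp (f := fun q : EuclideanSpace ℝ (Fin d) × ℝ => ‖q.1‖)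
          (hψ _ (norm_pos_iff.2 hq)).continuousAt cn
      exact ((((continuousAt_const.mul cM).mul (cφ q hq ht.1).continuousAt).sub
        (((continuousAt_const.mul c1).mul c4).mul (cW q hq).continuousAt)).sub
        ((c2.mul c3).mul ((cW q hq).continuousAt.sub (continuousAt_const.mul
          ((cX q hq).continuousAt.pow 2))))).continuousWithinAt
    · intro q _ hq
      simp [fluxSource, φ0 q hq, hψ0 _ (norm_nonneg _) hq, hψ0' _ (norm_nonneg _) hq]
    · intro q ht hq
      have : R ≤ q.2 + ‖q.1‖ := by linarith [ht.1]
      simp [fluxSource, φR q this, hχ0 _ this, hχ0' _ this]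
  -- the time derivative of the energy is integrable
  have hIeq : ∀ q : EuclideanSpace ℝ (Fin d) × ℝ, q.1 ≠ 0 → 0 ≤ q.2 →
      HasDerivAt (fun t => fluxTime l c G χ ψ u w g (q.1, t))
        (fderiv ℝ (fluxTime l c G χ ψ u w g) q (0, 1)) q.2 := fun q hq ht =>
    hasDerivAt_slice_snd ((cQ q hq ht).differentiableAt one_ne_zero)
  set I : EuclideanSpace ℝ (Fin d) × ℝ → ℝ :=
    fun q => deriv (fun t => fluxTime l c G χ ψ u w g (q.1, t)) q.2 with hIdef
  have hIc : ContinuousOn I ({0}ᶜ ×ˢ Set.Icc 0 R) := by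
    have : ContinuousOn (fun q => fderiv ℝ (fluxTime l c G χ ψ u w g) q (0, 1))
        ({0}ᶜ ×ˢ Set.Icc 0 R) := fun q hq =>
      ((((cQ q hq.1 hq.2.1).fderiv_right (m := 0) (by simp)).continuousAt).clm_apply
        continuousAt_const).continuousWithinAt
    exact this.congr fun q hq => (hIeq q hq.1 hq.2.1).deriv
  have hI : Integrable I (volume.prod (volume.restrict (Set.Ioc 0 R))) := by
    refine integrable_prod_of_continuousOn_annulus (b := R + 1) hα hIc ?_ ?_
    · intro q _ hq
      have : (fun t => fluxTime l c G χ ψ u w g (q.1, t)) = fun _ => 0 := by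
        ext t
        simp [fluxTime, φ0 (q.1, t) hq]
      simp [hIdef, this]
    · intro q ht hq
      have : (fun t => fluxTime l c G χ ψ u w g (q.1, t)) =ᶠ[𝓝 q.2] fun _ => 0 := by
        filter_upwards [Ioi_mem_nhds (show (-1 : ℝ) < q.2 by linarith [ht.1])] with t ht
        have ht : -1 < t := ht
        simp [fluxTime, φR (q.1, t) (by dsimp only; linarith)]
      rw [hIdef]
      dsimp only
      rw [this.deriv_eq, deriv_const]
  have hQ0 : Integrable (fun x => fluxTime l c G χ ψ u w g (x, 0)) := by
    refine integrable_of_continuousOn_annulus (b := R) hα ?_ ?_ ?_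
    · intro x hx
      exact (ContinuousAt.comp (f := fun y : EuclideanSpace ℝ (Fin d) => (y, (0 : ℝ)))
        (cQ (x, 0) hx le_rfl).continuousAt (by fun_prop)).continuousWithinAt
    · intro x hx
      simp [fluxTime, φ0 (x, 0) hx]
    · intro x hx
      simp [fluxTime, φR (x, 0) (by simpa using hx)]
  refine ⟨hS, hQ0, ?_⟩
  have hae : ∀ᵐ x : EuclideanSpace ℝ (Fin d), x ≠ 0 :=
    compl_mem_ae_iff.2 (measure_singleton (0 : EuclideanSpace ℝ (Fin d)))
  have hIint : ∫ q, I q ∂(volume.prod (volume.restrict (Set.Ioc 0 R)))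
      = -∫ x, fluxTime l c G χ ψ u w g (x, 0) := by
    rw [integral_prod _ hI, ← integral_neg]
    refine integral_congr_ae ?_
    filter_upwards [hae] with x hx
    rw [← intervalIntegral.integral_of_le hR.le, intervalIntegral.integral_eq_sub_of_hasDerivAt
      (f := fun t => fluxTime l c G χ ψ u w g (x, t))]
    · simp [fluxTime, φR (x, R) (by simp)]
    · intro t ht
      rw [Set.uIcc_of_le hR.le] at ht
      rw [hIdef]
      dsimp only
      rw [(hIeq (x, t) hx ht.1).deriv]
      exact hIeq (x, t) hx ht.1
    · refine ContinuousOn.intervalIntegrable ?_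
      rw [Set.uIcc_of_le hR.le]
      exact hIc.comp (f := fun t : ℝ => (x, t)) (by fun_prop) fun t ht => ⟨hx, ht⟩
  have hzero : ∫ q, (fluxSource l c f G χ χ' ψ ψ' u w g q + I q)
      ∂(volume.prod (volume.restrict (Set.Ioc 0 R))) = 0 := by
    refine (integral_prod_symm _ (hS.add hI)).trans (integral_eq_zero_of_ae ?_)
    filter_upwards [ae_restrict_mem measurableSet_Ioc] with t ht
    have sl : ∀ {Z : Type} [NormedAddCommGroup Z] [NormedSpace ℝ Z]
        (F : EuclideanSpace ℝ (Fin d) × ℝ → Z) x, ContDiffAt ℝ 1 F (x, t) →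
        ContDiffAt ℝ 1 (fun y => F (y, t)) x := fun F x h =>
      ContDiffAt.comp (f := fun y : EuclideanSpace ℝ (Fin d) => (y, t)) x h
        (contDiffAt_id.prodMk contDiffAt_const)
    have z1 : ∀ᶠ x : EuclideanSpace ℝ (Fin d) in 𝓝 0, coneWeight χ ψ (x, t) = 0 := by
      filter_upwards [Metric.ball_mem_nhds 0 hα] with x hx
      exact φ0 (x, t) (by simpa using (mem_ball_zero_iff.1 hx).le)
    have z2 : ∀ x : EuclideanSpace ℝ (Fin d), x ∉ Metric.closedBall 0 R →
        coneWeight χ ψ (x, t) = 0 := fun x hx => by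
      refine φR (x, t) ?_
      simp only [mem_closedBall_zero_iff, not_le] at hx
      dsimp only
      linarith [ht.1]
    have hdiv := integral_divergence_smul_add_smul hd
      (fun x hx => sl _ x (cA (x, t) hx ht.1.le)) (fun x hx => sl _ x (cB (x, t) hx ht.1.le))
      (fun x hx => sl _ x (J.contDiffAt_g (x, t) hx))
      (by filter_upwards [z1] with x hx; simp [fluxRad, hx])
      (by filter_upwards [z1] with x hx; simp [fluxGrad, hx])
      (HasCompactSupport.intro (isCompact_closedBall 0 R) fun x hx => by simp [fluxRad, z2 x hx])
      (HasCompactSupport.intro (isCompact_closedBall 0 R) fun x hx => by simp [fluxGrad, z2 x hx])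
    rw [Pi.zero_apply, ← neg_eq_zero, ← integral_neg, ← hdiv]
    refine integral_congr_ae ?_
    filter_upwards [hae] with x hx
    have hid := J.flux_identity (q := (x, t)) hx hG hG' (cdχ _ (pos (x, t) hx ht.1.le))
      (hχ _ (pos (x, t) hx ht.1.le)) (cdψ _ (norm_pos_iff.2 hx)) (hψ _ (norm_pos_iff.2 hx)) hl
      (heq (x, t) hx)
    have e1 := (fderiv_slice_fst ((cA (x, t) hx ht.1.le).differentiableAt one_ne_zero)).fderiv
    have e2 := (fderiv_slice_fst ((cB (x, t) hx ht.1.le).differentiableAt one_ne_zero)).fderiv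
    have e3 := (fderiv_slice_fst
      ((J.contDiffAt_g (x, t) hx).differentiableAt one_ne_zero)).fderiv
    have e4 : I (x, t) = _ := (hIeq (x, t) hx ht.1.le).deriv
    dsimp only at e1 e2 e3 hid e4 ⊢
    rw [Pi.add_apply, e1, e2, e3, e4, ← hc]
    simp only [ContinuousLinearMap.comp_apply, ContinuousLinearMap.inl_apply,
      J.fderiv_g (x, t) hx, zero_smul, add_zero]
    linarith
  rw [integral_add hS hI, hIint] at hzero
  linarith

end SpacetimeIdentity

section Cutoffs

open scoped Topology

lemma hasDerivAt_sq_max_zero (y : ℝ) : HasDerivAt (fun y : ℝ => max y 0 ^ 2) (2 * max y 0) y := by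
  rcases lt_trichotomy y 0 with h | rfl | h
  · rw [max_eq_right h.le, mul_zero]
    refine (hasDerivAt_const y (0 : ℝ)).congr_of_eventuallyEq ?_
    filter_upwards [Iio_mem_nhds h] with z hz
    simp [max_eq_right (Set.mem_Iio.1 hz).le]
  · rw [max_self, mul_zero, hasDerivAt_iff_isLittleO_nhds_zero]
    refine (Asymptotics.IsBigO.of_bound 1 (Eventually.of_forall fun z => ?_)).trans_isLittleO
      (g := fun z : ℝ => z ^ 2) ?_
    · simp only [zero_add, max_self, smul_zero, sub_zero, Real.norm_eq_abs, one_mul, ne_eq,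
        OfNat.ofNat_ne_zero, not_false_eq_true, zero_pow, abs_pow]
      refine pow_le_pow_left₀ (abs_nonneg _) ?_ 2
      rw [abs_of_nonneg (le_max_right z 0)]
      exact max_le (le_abs_self z) (abs_nonneg z)
    · simpa using Asymptotics.isLittleO_pow_pow (𝕜 := ℝ) (show 1 < 2 by norm_num)
  · rw [max_eq_left h.le]
    refine HasDerivAt.congr_of_eventuallyEq (f := fun y => y ^ 2) (by simpa using hasDerivAt_pow 2 y) ?_
    filter_upwards [Ioi_mem_nhds h] with z hz
    simp [max_eq_left (Set.mem_Ioi.1 hz).le]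

/-- The weight `s ^ κ` cut off at `s = R`. -/
noncomputable def timeCutoff (κ R s : ℝ) : ℝ := s ^ κ * max (1 - s / R) 0 ^ 2

/-- The derivative of `timeCutoff`. -/
noncomputable def timeCutoffDeriv (κ R s : ℝ) : ℝ :=
  κ * s ^ (κ - 1) * max (1 - s / R) 0 ^ 2 - s ^ κ * (2 * max (1 - s / R) 0 / R)

lemma hasDerivAt_timeCutoff {κ R s : ℝ} (hs : 0 < s) :
    HasDerivAt (timeCutoff κ R) (timeCutoffDeriv κ R s) s := by
  have h1 := Real.hasDerivAt_rpow_const (x := s) (p := κ) (Or.inl hs.ne')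
  have h2 : HasDerivAt (fun s : ℝ => 1 - s / R) (-(1 / R)) s := by
    simpa using ((hasDerivAt_id s).div_const R).const_sub 1
  refine (h1.mul ((hasDerivAt_sq_max_zero (1 - s / R)).comp s h2)).congr_deriv ?_
  simp only [timeCutoffDeriv, Function.comp]
  ring

lemma continuousOn_timeCutoffDeriv (κ R : ℝ) :
    ContinuousOn (timeCutoffDeriv κ R) (Set.Ioi 0) := by
  have h : ∀ e : ℝ, ContinuousOn (fun s : ℝ => s ^ e) (Set.Ioi 0) := fun e =>
    continuousOn_id.rpow_const fun s hs => Or.inl (ne_of_gt hs)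
  have h' : ContinuousOn (fun s : ℝ => max (1 - s / R) 0) (Set.Ioi 0) := by fun_prop
  exact ((continuousOn_const.mul (h _)).mul (h'.pow 2)).sub
    ((h _).mul ((continuousOn_const.mul h').div_const R))

lemma max_one_sub_div_eq_zero {R s : ℝ} (hR : 0 < R) (hs : R ≤ s) : max (1 - s / R) 0 = 0 :=
  max_eq_right (by rw [sub_nonpos]; exact (one_le_div hR).2 hs)

lemma timeCutoff_eq_zero {κ R s : ℝ} (hR : 0 < R) (hs : R ≤ s) : timeCutoff κ R s = 0 := by
  simp [timeCutoff, max_one_sub_div_eq_zero hR hs]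

lemma timeCutoffDeriv_eq_zero {κ R s : ℝ} (hR : 0 < R) (hs : R ≤ s) :
    timeCutoffDeriv κ R s = 0 := by
  simp [timeCutoffDeriv, max_one_sub_div_eq_zero hR hs]

lemma timeCutoff_nonneg {κ R s : ℝ} (hs : 0 ≤ s) : 0 ≤ timeCutoff κ R s := by
  unfold timeCutoff; positivity

lemma timeCutoff_le {κ R s : ℝ} (hR : 0 < R) (hs : 0 ≤ s) : timeCutoff κ R s ≤ s ^ κ := by
  have h : max (1 - s / R) 0 ≤ 1 := max_le (by rw [sub_le_self_iff]; positivity) zero_le_one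
  exact mul_le_of_le_one_right (by positivity) (pow_le_one₀ (le_max_right _ _) h)

lemma mul_timeCutoffDeriv_le {κ R s : ℝ} (hR : 0 < R) (hs : 0 < s) :
    s * timeCutoffDeriv κ R s ≤ κ * timeCutoff κ R s := by
  have h1 : s * s ^ (κ - 1) = s ^ κ := by rw [Real.rpow_sub_one hs.ne']; field_simp
  have h2 : 0 ≤ s * (s ^ κ * (2 * max (1 - s / R) 0 / R)) := by positivity
  rw [timeCutoff, timeCutoffDeriv, ← h1]
  rw [← h1] at h2
  linarith

lemma tendsto_timeCutoff (κ s : ℝ) :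
    Tendsto (fun n : ℕ => timeCutoff κ ((n : ℝ) + 1) s) atTop (𝓝 (s ^ κ)) := by
  have h : Tendsto (fun n : ℕ => s / ((n : ℝ) + 1)) atTop (𝓝 0) := by
    simpa [div_eq_mul_inv] using (tendsto_one_div_add_atTop_nhds_zero_nat (𝕜 := ℝ)).const_mul s
  have h1 := (((h.const_sub 1).max (tendsto_const_nhds (x := (0 : ℝ)))).pow 2).const_mul (s ^ κ)
  simpa [timeCutoff] using h1

/-- A cutoff function vanishing for `r ≤ α` and tending to `1` as `α → 0`. -/
noncomputable def originCutoff (γ α r : ℝ) : ℝ :=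
  max (1 - α ^ 2 / r ^ 2) 0 ^ 2 * (r ^ γ / (r ^ γ + α ^ (γ - 1)))

/-- The derivative of `originCutoff`. -/
noncomputable def originCutoffDeriv (γ α r : ℝ) : ℝ :=
  2 * max (1 - α ^ 2 / r ^ 2) 0 * (2 * α ^ 2 / r ^ 3) * (r ^ γ / (r ^ γ + α ^ (γ - 1)))
    + max (1 - α ^ 2 / r ^ 2) 0 ^ 2 * (γ * r ^ (γ - 1) * α ^ (γ - 1) / (r ^ γ + α ^ (γ - 1)) ^ 2)

lemma hasDerivAt_originCutoff {γ α r : ℝ} (hα : 0 < α) (hr : 0 < r) :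
    HasDerivAt (originCutoff γ α) (originCutoffDeriv γ α r) r := by
  have h1 := Real.hasDerivAt_rpow_const (x := r) (p := γ) (Or.inl hr.ne')
  have h2 : HasDerivAt (fun r : ℝ => 1 - α ^ 2 / r ^ 2) (2 * α ^ 2 / r ^ 3) r := by
    refine (((hasDerivAt_const r (α ^ 2)).div (hasDerivAt_pow 2 r) (by positivity)).const_sub
      1).congr_deriv ?_
    field_simp
    simp
    ring
  have h3 := ((hasDerivAt_sq_max_zero (1 - α ^ 2 / r ^ 2)).comp r h2).mul
    (h1.div (h1.add_const (α ^ (γ - 1))) (by positivity))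
  refine h3.congr_deriv ?_
  simp only [originCutoffDeriv, Function.comp]
  congr 2
  ring

lemma continuousOn_originCutoffDeriv {γ α : ℝ} (hα : 0 < α) :
    ContinuousOn (originCutoffDeriv γ α) (Set.Ioi 0) := by
  have h : ∀ e : ℝ, ContinuousOn (fun s : ℝ => s ^ e) (Set.Ioi 0) := fun e =>
    continuousOn_id.rpow_const fun s hs => Or.inl (ne_of_gt hs)
  have hp : ∀ r ∈ Set.Ioi (0 : ℝ), r ^ γ + α ^ (γ - 1) ≠ 0 := fun r hr => by
    have : 0 < r := hr
    positivity
  have h' : ContinuousOn (fun r : ℝ => max (1 - α ^ 2 / r ^ 2) 0) (Set.Ioi 0) :=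
    ContinuousOn.sup (continuousOn_const.sub (continuousOn_const.div (continuousOn_id.pow 2)
      fun r hr => pow_ne_zero _ (ne_of_gt hr))) continuousOn_const
  exact (((continuousOn_const.mul h').mul (continuousOn_const.div (continuousOn_id.pow 3)
    fun r hr => pow_ne_zero _ (ne_of_gt hr))).mul
      ((h _).div ((h _).add continuousOn_const) hp)).add
    ((h'.pow 2).mul (((continuousOn_const.mul (h _)).mul continuousOn_const).div
      (((h _).add continuousOn_const).pow 2) fun r hr => pow_ne_zero _ (hp r hr)))

lemma max_one_sub_sq_div_eq_zero {α r : ℝ} (hr : 0 < r) (h : r ≤ α) :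
    max (1 - α ^ 2 / r ^ 2) 0 = 0 :=
  max_eq_right (by rw [sub_nonpos, one_le_div (by positivity)]; gcongr)

lemma originCutoff_eq_zero {γ α r : ℝ} (hγ : 1 < γ) (hr : 0 ≤ r) (h : r ≤ α) :
    originCutoff γ α r = 0 := by
  rcases hr.eq_or_lt with rfl | hr
  · simp [originCutoff, Real.zero_rpow (by linarith : γ ≠ 0)]
  · simp [originCutoff, max_one_sub_sq_div_eq_zero hr h]

lemma originCutoffDeriv_eq_zero {γ α r : ℝ} (hγ : 1 < γ) (hr : 0 ≤ r) (h : r ≤ α) :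
    originCutoffDeriv γ α r = 0 := by
  rcases hr.eq_or_lt with rfl | hr
  · simp [originCutoffDeriv, Real.zero_rpow (by linarith : γ - 1 ≠ 0)]
  · simp [originCutoffDeriv, max_one_sub_sq_div_eq_zero hr h]

lemma originCutoff_nonneg {γ α r : ℝ} (hα : 0 ≤ α) (hr : 0 ≤ r) : 0 ≤ originCutoff γ α r := by
  unfold originCutoff; positivity

lemma originCutoff_le_one {γ α r : ℝ} (hα : 0 ≤ α) (hr : 0 ≤ r) : originCutoff γ α r ≤ 1 := by
  have h : max (1 - α ^ 2 / r ^ 2) 0 ≤ 1 := max_le (by rw [sub_le_self_iff]; positivity) zero_le_one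
  refine mul_le_one₀ (pow_le_one₀ (le_max_right _ _) h) (by positivity) ?_
  exact div_le_one_of_le₀ (le_add_of_nonneg_right (by positivity)) (by positivity)

lemma originCutoffDeriv_nonneg {γ α r : ℝ} (hγ : 0 ≤ γ) (hα : 0 ≤ α) (hr : 0 ≤ r) :
    0 ≤ originCutoffDeriv γ α r := by
  unfold originCutoffDeriv; positivity

lemma mul_originCutoffDeriv_le {γ α r : ℝ} (hγ : 0 ≤ γ) (hγ3 : γ ≤ 3) (hα : 0 < α) (hr : 0 < r) :
    r * originCutoffDeriv γ α r ≤ γ * originCutoff γ α r + 4 * r := by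
  have h1 : r * r ^ (γ - 1) = r ^ γ := by rw [Real.rpow_sub_one hr.ne']; field_simp
  set m := max (1 - α ^ 2 / r ^ 2) 0 with hm
  have hm0 : 0 ≤ m := le_max_right _ _
  have hm1 : m ≤ 1 := max_le (by rw [sub_le_self_iff]; positivity) zero_le_one
  have hA : 0 < r ^ γ := by positivity
  have hε : 0 < α ^ (γ - 1) := by positivity
  have hB : m ^ 2 * (γ * (r * r ^ (γ - 1)) * α ^ (γ - 1) / (r ^ γ + α ^ (γ - 1)) ^ 2)
      ≤ γ * (m ^ 2 * (r ^ γ / (r ^ γ + α ^ (γ - 1)))) := by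
    rw [h1, show γ * (m ^ 2 * (r ^ γ / (r ^ γ + α ^ (γ - 1))))
      = m ^ 2 * (γ * r ^ γ * (r ^ γ + α ^ (γ - 1)) / (r ^ γ + α ^ (γ - 1)) ^ 2) by field_simp]
    gcongr
    linarith
  have hC : m * (α ^ 2 / r ^ 2 * (r ^ γ / (r ^ γ + α ^ (γ - 1)))) ≤ 1 * r := by
    rcases le_total r α with h | h
    · rw [hm, max_one_sub_sq_div_eq_zero hr h, zero_mul]
      positivity
    · refine mul_le_mul hm1 ?_ (by positivity) zero_le_one
      have h2 : r ^ (γ - 3) ≤ α ^ (γ - 3) :=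
        Real.rpow_le_rpow_of_nonpos hα h (by linarith)
      have h3 : r ^ γ = r ^ (γ - 3) * r ^ 3 := by
        rw [← Real.rpow_natCast r 3, ← Real.rpow_add hr]; norm_num
      have h4 : α ^ (γ - 1) = α ^ (γ - 3) * α ^ 2 := by
        rw [← Real.rpow_natCast α 2, ← Real.rpow_add hα]; congr 1; push_cast; ring
      rw [div_mul_div_comm, div_le_iff₀ (by positivity)]
      calc α ^ 2 * r ^ γ = α ^ 2 * r ^ (γ - 3) * r ^ 3 := by rw [h3]; ring
        _ ≤ α ^ 2 * α ^ (γ - 3) * r ^ 3 := by gcongr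
        _ = r * (r ^ 2 * α ^ (γ - 1)) := by rw [h4]; ring
        _ ≤ r * (r ^ 2 * (r ^ γ + α ^ (γ - 1))) := by gcongr; linarith
  have hD : r * originCutoffDeriv γ α r
      = 4 * (m * (α ^ 2 / r ^ 2 * (r ^ γ / (r ^ γ + α ^ (γ - 1)))))
        + m ^ 2 * (γ * (r * r ^ (γ - 1)) * α ^ (γ - 1) / (r ^ γ + α ^ (γ - 1)) ^ 2) := by
    rw [originCutoffDeriv, ← hm]
    field_simp
    ring
  rw [hD, originCutoff, ← hm]
  linarith

lemma tendsto_originCutoff {γ r : ℝ} (hγ : 1 < γ) (hr : 0 < r) :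
    Tendsto (fun α => originCutoff γ α r) (𝓝 0) (𝓝 1) := by
  have h1 : Tendsto (fun α : ℝ => α ^ (γ - 1)) (𝓝 0) (𝓝 0) := by
    have := (Real.continuous_rpow_const (q := γ - 1) (by linarith)).tendsto 0
    rwa [Real.zero_rpow (by linarith)] at this
  have h2 : Tendsto (fun α : ℝ => max (1 - α ^ 2 / r ^ 2) 0) (𝓝 0) (𝓝 1) := by
    have : Continuous fun α : ℝ => max (1 - α ^ 2 / r ^ 2) 0 := by fun_prop
    simpa using this.tendsto 0
  have hA : r ^ γ ≠ 0 := by positivity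
  have h3 := (h2.pow 2).mul ((tendsto_const_nhds (x := r ^ γ)).div (h1.const_add (r ^ γ))
    (by simpa using hA))
  simpa [originCutoff, hA] using h3

lemma tendsto_originCutoffDeriv {γ r : ℝ} (hγ : 1 < γ) (hr : 0 < r) :
    Tendsto (fun α => originCutoffDeriv γ α r) (𝓝 0) (𝓝 0) := by
  have h1 : Tendsto (fun α : ℝ => α ^ (γ - 1)) (𝓝 0) (𝓝 0) := by
    have := (Real.continuous_rpow_const (q := γ - 1) (by linarith)).tendsto 0
    rwa [Real.zero_rpow (by linarith)] at this
  have h2 : Tendsto (fun α : ℝ => max (1 - α ^ 2 / r ^ 2) 0) (𝓝 0) (𝓝 1) := by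
    have : Continuous fun α : ℝ => max (1 - α ^ 2 / r ^ 2) 0 := by fun_prop
    simpa using this.tendsto 0
  have h4 : Tendsto (fun α : ℝ => 2 * α ^ 2 / r ^ 3) (𝓝 0) (𝓝 0) := by
    have : Continuous fun α : ℝ => 2 * α ^ 2 / r ^ 3 := by fun_prop
    simpa using this.tendsto 0
  have hA : r ^ γ ≠ 0 := by positivity
  have h3 := (((h2.const_mul 2).mul h4).mul
    ((tendsto_const_nhds (x := r ^ γ)).div (h1.const_add (r ^ γ)) (by simpa using hA))).add
    ((h2.pow 2).mul ((h1.const_mul (γ * r ^ (γ - 1))).div ((h1.const_add (r ^ γ)).pow 2)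
    (by simpa using hA)))
  simpa [originCutoffDeriv] using h3

end Cutoffs

section PointwiseBounds

open scoped RealInnerProductSpace Topology

variable {F : Type*} [NormedAddCommGroup F] [InnerProductSpace ℝ F]

lemma sq_radPart_le (g : F × ℝ → F) (q : F × ℝ) : radPart g q ^ 2 ≤ ‖g q‖ ^ 2 := by
  have h1 : ‖radDir q.1‖ ≤ 1 := by
    rw [radDir, norm_smul, norm_inv, norm_norm]
    exact inv_mul_le_one
  have h2 : |radPart g q| ≤ ‖g q‖ := (abs_real_inner_le_norm _ _).trans
    (mul_le_of_le_one_left (norm_nonneg _) h1)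
  exact sq_le_sq.2 (h2.trans (le_abs_self _))

variable {u w : F × ℝ → ℝ} {g : F × ℝ → F} {f G : ℝ → ℝ} {l c κ R : ℝ}

lemma tangDen_nonneg (hl : 0 ≤ l) (hG0 : ∀ y, 0 ≤ G y) (q : F × ℝ) : 0 ≤ tangDen l G u g q := by
  have h1 := sub_nonneg.2 (sq_radPart_le g q)
  have h2 := hG0 (u q)
  unfold tangDen
  positivity

lemma add_le_two_mul_mul_morDen (hGf : ∀ y, G y ≤ c * (y * f y - 2 * G y))
    (hl : 0 ≤ l) {q : F × ℝ} (hq : q.1 ≠ 0) :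
    tangDen l G u g q + 1 / 2 * (‖g q‖ ^ 2 - radPart g q ^ 2) ≤ 2 * (‖q.1‖ * morDen l c f G u g q) := by
  have hr : 0 < ‖q.1‖ := norm_pos_iff.2 hq
  have h : 2 * (‖q.1‖ * morDen l c f G u g q) = (‖g q‖ ^ 2 - radPart g q ^ 2)
      + 2 * (l / 2 * u q ^ 2 / ‖q.1‖ ^ 2) + u q ^ 2 / (2 * ‖q.1‖)
      + c * (u q * f (u q) - 2 * G (u q)) := by
    unfold morDen
    field_simp
    ring
  have h2 : 0 ≤ l / 2 * u q ^ 2 / ‖q.1‖ ^ 2 := by positivity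
  rw [h, tangDen]
  linarith [hGf (u q)]

lemma tangDen_le_two_mul_mul_morDen (hGf : ∀ y, G y ≤ c * (y * f y - 2 * G y))
    (hl : 0 ≤ l) {q : F × ℝ} (hq : q.1 ≠ 0) :
    tangDen l G u g q ≤ 2 * (‖q.1‖ * morDen l c f G u g q) := by
  linarith [add_le_two_mul_mul_morDen (u := u) (g := g) hGf hl hq, sq_radPart_le g q]

lemma morDen_nonneg (hG0 : ∀ y, 0 ≤ G y) (hGf : ∀ y, G y ≤ c * (y * f y - 2 * G y))
    (hl : 0 ≤ l) {q : F × ℝ} (hq : q.1 ≠ 0) : 0 ≤ morDen l c f G u g q := by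
  have h := (tangDen_nonneg hl hG0 q).trans (tangDen_le_two_mul_mul_morDen (u := u) (g := g)
    hGf hl hq)
  exact nonneg_of_mul_nonneg_right (by linarith) (norm_pos_iff.2 hq)

lemma mul_timeCutoffDeriv_le_of_le (hκ : 0 ≤ κ) (hR : 0 < R) {r s : ℝ} (hr : 0 < r) (hs : r ≤ s) :
    r * timeCutoffDeriv κ R s ≤ κ * timeCutoff κ R s := by
  rcases le_total 0 (timeCutoffDeriv κ R s) with h | h
  · exact (mul_le_mul_of_nonneg_right hs h).trans (mul_timeCutoffDeriv_le hR (hr.trans_le hs))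
  · exact (mul_nonpos_of_nonneg_of_nonpos hr.le h).trans
      (mul_nonneg hκ (timeCutoff_nonneg (hr.le.trans hs)))

/-- A lower bound for the flux source, uniform in the cutoff at the origin. -/
lemma neg_le_fluxSource (hG0 : ∀ y, 0 ≤ G y) (hGf : ∀ y, G y ≤ c * (y * f y - 2 * G y))
    (hl : 0 ≤ l) (hκ0 : 0 < κ) (hκ1 : κ < 1 / 2) (hR : 0 < R) {α : ℝ} (hα : 0 < α)
    {q : F × ℝ} (hq : q.1 ≠ 0) (ht : 0 ≤ q.2) {C : ℝ} (hC : 0 ≤ C)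
    (hB : ‖q.1‖ ≤ R → ‖q.1‖ ^ 2 * (l / 2 * u q ^ 2 / ‖q.1‖ ^ 2 + u q ^ 2 / (2 * ‖q.1‖)
      + G (u q)) ≤ C) :
    -(2 * R ^ κ * ‖g q‖ ^ 2
      + R ^ κ * (2 + 4 * R) * C * (Metric.closedBall (0 : F) R).indicator (fun x => ‖x‖ ^ (-3 : ℝ)) q.1)
      ≤ fluxSource l c f G (timeCutoff κ R) (timeCutoffDeriv κ R) (originCutoff (2 - 2 * κ) α)
        (originCutoffDeriv (2 - 2 * κ) α) u w g q := by
  have hr : 0 < ‖q.1‖ := norm_pos_iff.2 hq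
  have hind : 0 ≤ (Metric.closedBall (0 : F) R).indicator (fun x => ‖x‖ ^ (-3 : ℝ)) q.1 :=
    Set.indicator_nonneg (fun x _ => by positivity) _
  rcases le_or_gt R (q.2 + ‖q.1‖) with hs | hs
  · rw [fluxSource, coneWeight, timeCutoff_eq_zero hR hs, timeCutoffDeriv_eq_zero hR hs]
    simp only [zero_mul, mul_zero, sub_zero, Left.neg_nonpos_iff]
    positivity
  have hrR : ‖q.1‖ ≤ R := by linarith
  have hA0 := sub_nonneg.2 (sq_radPart_le g q)
  have hM := add_le_two_mul_mul_morDen (u := u) (g := g) hGf hl hq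
  have hχ0 : 0 ≤ timeCutoff κ R (q.2 + ‖q.1‖) := timeCutoff_nonneg (by positivity)
  have hχR : timeCutoff κ R (q.2 + ‖q.1‖) ≤ R ^ κ := (timeCutoff_le hR (by positivity)).trans
    (Real.rpow_le_rpow (by positivity) hs.le hκ0.le)
  have hχ' := mul_timeCutoffDeriv_le_of_le hκ0.le hR hr (show ‖q.1‖ ≤ q.2 + ‖q.1‖ by linarith)
  have hψ0 := originCutoff_nonneg (γ := 2 - 2 * κ) hα.le hr.le
  have hψ1 := originCutoff_le_one (γ := 2 - 2 * κ) hα.le hr.le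
  have hψ'0 := originCutoffDeriv_nonneg (γ := 2 - 2 * κ) (by linarith) hα.le hr.le
  have hψ' := mul_originCutoffDeriv_le (γ := 2 - 2 * κ) (by linarith) (by linarith) hα hr
  have hB' := hB hrR
  have hind' : (Metric.closedBall (0 : F) R).indicator (fun x => ‖x‖ ^ (-3 : ℝ)) q.1
      = (‖q.1‖ ^ 3)⁻¹ := by
    rw [Set.indicator_of_mem (by simpa using hrR), Real.rpow_neg hr.le]
    norm_cast
  have hB0 : 0 ≤ l / 2 * u q ^ 2 / ‖q.1‖ ^ 2 + u q ^ 2 / (2 * ‖q.1‖) + G (u q) := by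
    have := hG0 (u q)
    positivity
  have hW : tangDen l G u g q = (‖g q‖ ^ 2 - radPart g q ^ 2) / 2
      + (l / 2 * u q ^ 2 / ‖q.1‖ ^ 2 + u q ^ 2 / (2 * ‖q.1‖) + G (u q)) := by
    rw [tangDen]
    ring
  rw [hind', fluxSource, coneWeight]
  rw [hW] at hM ⊢
  have hRκ : 0 < R ^ κ := by positivity
  have hgA : ‖g q‖ ^ 2 - radPart g q ^ 2 ≤ ‖g q‖ ^ 2 := sub_le_self _ (sq_nonneg _)
  generalize morDen l c f G u g q = M at *
  generalize timeCutoff κ R (q.2 + ‖q.1‖) = χ at *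
  generalize timeCutoffDeriv κ R (q.2 + ‖q.1‖) = χ' at *
  generalize originCutoff (2 - 2 * κ) α ‖q.1‖ = ψ at *
  generalize originCutoffDeriv (2 - 2 * κ) α ‖q.1‖ = ψ' at *
  generalize l / 2 * u q ^ 2 / ‖q.1‖ ^ 2 + u q ^ 2 / (2 * ‖q.1‖) + G (u q) = B at *
  generalize outDer c u w g q = X at *
  generalize ‖g q‖ ^ 2 - radPart g q ^ 2 = A at *
  generalize ‖g q‖ ^ 2 = g2 at *
  generalize R ^ κ = P at *
  generalize ‖q.1‖ = r at *
  have e1 : χ * ψ * (A + B) ≤ 2 * (r * M) * (χ * ψ) := by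
    nlinarith [mul_nonneg hχ0 hψ0]
  have e2 : 2 * (r * χ') * ψ * (A / 2 + B) ≤ 2 * (κ * χ) * ψ * (A / 2 + B) := by
    gcongr
  have e3 : χ * (r * ψ') * (A / 2 + B - 1 / 2 * X ^ 2)
      ≤ χ * ((2 - 2 * κ) * ψ + 4 * r) * (A / 2 + B) := by
    calc χ * (r * ψ') * (A / 2 + B - 1 / 2 * X ^ 2) ≤ χ * (r * ψ') * (A / 2 + B) := by
          gcongr
          linarith [sq_nonneg X]
      _ ≤ _ := by gcongr
  have e4 : χ * ((2 - 2 * κ) * ψ + 4 * r) * B ≤ P * (2 + 4 * R) * B := by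
    have h1 : (2 - 2 * κ) * ψ ≤ 2 := by linarith [mul_nonneg hκ0.le hψ0]
    have h2 : 0 ≤ (2 - 2 * κ) * ψ := mul_nonneg (by linarith) hψ0
    gcongr
  have e5 : 0 ≤ χ * ψ * ((1 - 2 * κ) * B) :=
    mul_nonneg (mul_nonneg hχ0 hψ0) (mul_nonneg (by linarith) hB0)
  have e6 : χ * (2 * r * A) ≤ P * (2 * r * g2) := by gcongr
  have e7 : -(P * (2 * r * g2) + P * (2 + 4 * R) * B)
      ≤ r * (2 * M * (χ * ψ) - 2 * χ' * ψ * (A / 2 + B) - χ * ψ' * (A / 2 + B - 1 / 2 * X ^ 2)) := by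
    linarith
  have e8 : P * (2 + 4 * R) * B ≤ P * (2 + 4 * R) * (C / r ^ 2) := by
    gcongr
    rw [le_div_iff₀ (by positivity)]
    linarith
  refine le_of_mul_le_mul_left ?_ hr
  refine le_trans (le_of_eq ?_) ((neg_le_neg (add_le_add_right e8 (P * (2 * r * g2)))).trans e7)
  field_simp

/-- The limit of the flux source as the cutoff at the origin is removed. -/
lemma tendsto_fluxSource (hκ1 : κ < 1 / 2) {q : F × ℝ} (hq : q.1 ≠ 0) :
    Tendsto (fun α => fluxSource l c f G (timeCutoff κ R) (timeCutoffDeriv κ R)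
        (originCutoff (2 - 2 * κ) α) (originCutoffDeriv (2 - 2 * κ) α) u w g q) (𝓝 0)
      (𝓝 (2 * morDen l c f G u g q * timeCutoff κ R (q.2 + ‖q.1‖)
        - 2 * timeCutoffDeriv κ R (q.2 + ‖q.1‖) * tangDen l G u g q)) := by
  have hr : 0 < ‖q.1‖ := norm_pos_iff.2 hq
  have h1 := tendsto_originCutoff (γ := 2 - 2 * κ) (by linarith) hr
  have h2 := tendsto_originCutoffDeriv (γ := 2 - 2 * κ) (by linarith) hr
  have h3 := ((((h1.const_mul (timeCutoff κ R (q.2 + ‖q.1‖))).const_mul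
    (2 * morDen l c f G u g q)).sub ((h1.const_mul (2 * timeCutoffDeriv κ R (q.2 + ‖q.1‖))).mul_const
      (tangDen l G u g q))).sub ((h2.const_mul (timeCutoff κ R (q.2 + ‖q.1‖))).mul_const
        (tangDen l G u g q - 1 / 2 * outDer c u w g q ^ 2)))
  simpa [fluxSource, coneWeight] using h3

lemma mul_morDen_le (hG0 : ∀ y, 0 ≤ G y) (hGf : ∀ y, G y ≤ c * (y * f y - 2 * G y))
    (hl : 0 ≤ l) (hκ0 : 0 < κ) (hR : 0 < R) {q : F × ℝ} (hq : q.1 ≠ 0) (ht : 0 ≤ q.2) :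
    2 * (1 - 2 * κ) * (timeCutoff κ R (q.2 + ‖q.1‖) * morDen l c f G u g q)
      ≤ 2 * morDen l c f G u g q * timeCutoff κ R (q.2 + ‖q.1‖)
        - 2 * timeCutoffDeriv κ R (q.2 + ‖q.1‖) * tangDen l G u g q := by
  have hr : 0 < ‖q.1‖ := norm_pos_iff.2 hq
  have hM := tangDen_le_two_mul_mul_morDen (u := u) (g := g) hGf hl hq
  have hW := tangDen_nonneg (u := u) (g := g) hl hG0 q
  have hχ0 : 0 ≤ timeCutoff κ R (q.2 + ‖q.1‖) := timeCutoff_nonneg (by positivity)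
  have hχ' := mul_timeCutoffDeriv_le_of_le hκ0.le hR hr (show ‖q.1‖ ≤ q.2 + ‖q.1‖ by linarith)
  refine le_of_mul_le_mul_left ?_ hr
  have e1 := mul_le_mul_of_nonneg_right hχ' hW
  have e2 := mul_le_mul_of_nonneg_left hM (mul_nonneg hκ0.le hχ0)
  linarith

end PointwiseBounds

section Limits

open scoped RealInnerProductSpace Topology

variable {d : ℕ} {u w a : EuclideanSpace ℝ (Fin d) × ℝ → ℝ}
  {g k : EuclideanSpace ℝ (Fin d) × ℝ → EuclideanSpace ℝ (Fin d)}
  {H : EuclideanSpace ℝ (Fin d) × ℝ → EuclideanSpace ℝ (Fin d) →L[ℝ] EuclideanSpace ℝ (Fin d)}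
  {f G : ℝ → ℝ} {l c κ R : ℝ}

lemma integrable_indicator_norm_rpow_neg_three (hd : 4 ≤ d) (R : ℝ) :
    Integrable ((Metric.closedBall (0 : EuclideanSpace ℝ (Fin d)) R).indicator
      fun x => ‖x‖ ^ (-3 : ℝ)) := by
  rw [integrable_indicator_iff Metric.isClosed_closedBall.measurableSet]
  have h : IntegrableOn (fun x : EuclideanSpace ℝ (Fin d) => ‖x‖ ^ (-3 : ℝ))
      (Metric.ball 0 (R + 1)) := by
    refine integrableOn_ball_of_norm_le_rpow (C := 1) (α := 3) ?_ ?_ ?_ ?_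
    · rw [finrank_euclideanSpace_fin]
      omega
    · rw [finrank_euclideanSpace_fin]
      exact_mod_cast (by omega : 3 < d)
    · refine Eventually.of_forall fun x => ?_
      rw [one_mul, Real.norm_of_nonneg (by positivity)]
    · exact (measurable_norm.pow_const _).aestronglyMeasurable
  exact h.mono_set (Metric.closedBall_subset_ball (by linarith))

lemma exists_potential_bound {F : Type*} [NormedAddCommGroup F] [ProperSpace F] {u : F × ℝ → ℝ}
    (hu : Continuous u) (hG : Continuous G) (l R : ℝ) :
    ∃ C, 0 ≤ C ∧ ∀ q : F × ℝ, q.1 ≠ 0 → q.2 ∈ Set.Icc 0 R → ‖q.1‖ ≤ R →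
      ‖q.1‖ ^ 2 * (l / 2 * u q ^ 2 / ‖q.1‖ ^ 2 + u q ^ 2 / (2 * ‖q.1‖) + G (u q)) ≤ C := by
  have hK : IsCompact (Metric.closedBall (0 : F) R ×ˢ Set.Icc 0 R) :=
    (isCompact_closedBall 0 R).prod isCompact_Icc
  obtain ⟨C, hC⟩ := hK.exists_bound_of_continuousOn
    (f := fun q => l / 2 * u q ^ 2 + ‖q.1‖ * u q ^ 2 / 2 + ‖q.1‖ ^ 2 * G (u q)) (by fun_prop)
  refine ⟨max C 0, le_max_right _ _, fun q hq ht hR => ?_⟩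
  have hr : ‖q.1‖ ≠ 0 := norm_ne_zero_iff.2 hq
  refine le_trans (le_of_eq ?_) ((le_abs_self _).trans ((hC q ⟨by simpa using hR, ht⟩).trans
    (le_max_left _ _)))
  field_simp

/-- The weighted Morawetz estimate for the cut off weight `timeCutoff κ R`. -/
lemma IsWaveJet.lintegral_timeCutoff_mul_morDen_le (J : IsWaveJet u w a g k H) (hd : 4 ≤ d)
    (hu : Continuous u) (hG : ContDiff ℝ 1 G) (hG' : ∀ y, HasDerivAt G (f y) y)
    (hf : Continuous f) (hG0 : ∀ y, 0 ≤ G y) (hGf : ∀ y, G y ≤ c * (y * f y - 2 * G y))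
    (hl0 : 0 ≤ l) (hκ0 : 0 < κ) (hκ1 : κ < 1 / 2) (hR : 0 < R)
    (hc : 2 * c = d - 1) (hl : l = c * (c - 1))
    (heq : ∀ q : EuclideanSpace ℝ (Fin d) × ℝ, q.1 ≠ 0 →
      a q - ∑ i, ⟪H q (EuclideanSpace.single i 1), EuclideanSpace.single i 1⟫
        + u q / ‖q.1‖ + f (u q) = 0)
    (hg : Integrable (fun q => ‖g q‖ ^ 2) (volume.prod (volume.restrict (Set.Ioc 0 R))))
    (hInt : Integrable fun x : EuclideanSpace ℝ (Fin d) => ‖x‖ ^ κ *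
      (1 / 2 * outDer c u w g (x, 0) ^ 2 + tangDen l G u g (x, 0))) :
    ∫⁻ q, ENNReal.ofReal (2 * (1 - 2 * κ) * (timeCutoff κ R (q.2 + ‖q.1‖) * morDen l c f G u g q))
        ∂(volume.prod (volume.restrict (Set.Ioc 0 R)))
      ≤ ENNReal.ofReal (∫ x : EuclideanSpace ℝ (Fin d), ‖x‖ ^ κ *
        (1 / 2 * outDer c u w g (x, 0) ^ 2 + tangDen l G u g (x, 0))) := by
  have hne : Nonempty (Fin d) := ⟨⟨0, by omega⟩⟩
  obtain ⟨C, hC, hB⟩ := exists_potential_bound hu hG.continuous l R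
  set P := (volume : Measure (EuclideanSpace ℝ (Fin d))).prod
    (volume.restrict (Set.Ioc (0 : ℝ) R)) with hP
  set α : ℕ → ℝ := fun n => 1 / ((n : ℝ) + 1) with hα
  have hα0 : ∀ n, 0 < α n := fun n => by positivity
  set S : ℕ → EuclideanSpace ℝ (Fin d) × ℝ → ℝ := fun n =>
    fluxSource l c f G (timeCutoff κ R) (timeCutoffDeriv κ R) (originCutoff (2 - 2 * κ) (α n))
      (originCutoffDeriv (2 - 2 * κ) (α n)) u w g with hS
  set K := ∫ x : EuclideanSpace ℝ (Fin d), ‖x‖ ^ κ *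
    (1 / 2 * outDer c u w g (x, 0) ^ 2 + tangDen l G u g (x, 0)) with hK
  have hSn := fun n => J.integral_fluxSource (by omega) hG hG' hf hR (hα0 n)
    (fun s hs => hasDerivAt_timeCutoff (κ := κ) hs) (continuousOn_timeCutoffDeriv κ R)
    (fun s hs => timeCutoff_eq_zero hR hs) (fun s hs => timeCutoffDeriv_eq_zero hR hs)
    (fun r hr => hasDerivAt_originCutoff (γ := 2 - 2 * κ) (hα0 n) hr)
    (continuousOn_originCutoffDeriv (hα0 n))
    (fun r hr h => originCutoff_eq_zero (by linarith) hr h)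
    (fun r hr h => originCutoffDeriv_eq_zero (by linarith) hr h) hc hl heq
  have hSK : ∀ n, ∫ q, S n q ∂P ≤ K := fun n => by
    rw [(hSn n).2.2]
    refine integral_mono (hSn n).2.1 hInt fun x => ?_
    have h1 : coneWeight (timeCutoff κ R) (originCutoff (2 - 2 * κ) (α n)) (x, 0) ≤ ‖x‖ ^ κ := by
      simp only [coneWeight, zero_add]
      exact (mul_le_of_le_one_right (timeCutoff_nonneg (norm_nonneg _))
        (originCutoff_le_one (hα0 n).le (norm_nonneg _))).trans (timeCutoff_le hR (norm_nonneg _))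
    have h2 := tangDen_nonneg (u := u) (g := g) hl0 hG0 (x, 0)
    exact mul_le_mul_of_nonneg_right h1 (by positivity)
  set D : EuclideanSpace ℝ (Fin d) × ℝ → ℝ := fun q => 2 * R ^ κ * ‖g q‖ ^ 2
    + R ^ κ * (2 + 4 * R) * C * (Metric.closedBall (0 : EuclideanSpace ℝ (Fin d)) R).indicator
      (fun x => ‖x‖ ^ (-3 : ℝ)) q.1 with hD
  have hDint : Integrable D P := (hg.const_mul _).add
    (((integrable_indicator_norm_rpow_neg_three hd R).comp_fst _).const_mul _)
  have hD0 : ∀ q, 0 ≤ D q := fun q => by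
    have : 0 ≤ (Metric.closedBall (0 : EuclideanSpace ℝ (Fin d)) R).indicator
      (fun x => ‖x‖ ^ (-3 : ℝ)) q.1 := Set.indicator_nonneg (fun x _ => by positivity) _
    positivity
  have hae : ∀ᵐ q ∂P, q.1 ≠ 0 ∧ q.2 ∈ Set.Ioc 0 R := by
    have h1 : ∀ᵐ q ∂P, q.1 ≠ 0 := Measure.quasiMeasurePreserving_fst.ae
      (compl_mem_ae_iff.2 (measure_singleton (0 : EuclideanSpace ℝ (Fin d))))
    have h2 : ∀ᵐ q ∂P, q.2 ∈ Set.Ioc 0 R := Measure.quasiMeasurePreserving_snd.ae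
      (ae_restrict_mem measurableSet_Ioc)
    exact h1.and h2
  have hlow : ∀ n, 0 ≤ᵐ[P] S n + D := fun n => by
    filter_upwards [hae] with q ⟨hq, ht⟩
    have := neg_le_fluxSource (w := w) (g := g) hG0 hGf hl0 hκ0 hκ1 hR (hα0 n) hq ht.1.le hC
      (hB q hq (Set.Ioc_subset_Icc_self ht))
    simp only [Pi.zero_apply, Pi.add_apply, hD, hS]
    linarith
  have hbound : ∀ n, ∫⁻ q, ENNReal.ofReal (S n q + D q) ∂P
      ≤ ENNReal.ofReal K + ENNReal.ofReal (∫ q, D q ∂P) := fun n => by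
    have h1 := ofReal_integral_eq_lintegral_ofReal ((hSn n).1.add hDint) (hlow n)
    refine h1.symm.le.trans ?_
    rw [integral_add' (hSn n).1 hDint]
    exact (ENNReal.ofReal_le_ofReal (add_le_add_left (hSK n) _)).trans ENNReal.ofReal_add_le
  have hfatou : ∫⁻ q, ENNReal.ofReal (2 * (1 - 2 * κ) *
      (timeCutoff κ R (q.2 + ‖q.1‖) * morDen l c f G u g q) + D q) ∂P
      ≤ ENNReal.ofReal K + ENNReal.ofReal (∫ q, D q ∂P) := by
    calc _ ≤ ∫⁻ q, liminf (fun n => ENNReal.ofReal (S n q + D q)) atTop ∂P := by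
          refine lintegral_mono_ae ?_
          filter_upwards [hae] with q ⟨hq, ht⟩
          have h1 := (ENNReal.continuous_ofReal.tendsto _).comp
            (((tendsto_fluxSource (u := u) (w := w) (g := g) (f := f) (G := G) (l := l) (c := c)
              (R := R) hκ1 hq).comp tendsto_one_div_add_atTop_nhds_zero_nat).add_const (D q))
          refine le_trans ?_ (le_of_eq h1.liminf_eq.symm)
          gcongr
          exact mul_morDen_le hG0 hGf hl0 hκ0 hR hq ht.1.le
      _ ≤ liminf (fun n => ∫⁻ q, ENNReal.ofReal (S n q + D q) ∂P) atTop :=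
          lintegral_liminf_le' fun n => ((hSn n).1.add hDint).aemeasurable.ennreal_ofReal
      _ ≤ _ := liminf_le_of_le (by isBoundedDefault) fun b hb => by
          obtain ⟨n, hn⟩ := hb.exists
          exact hn.trans (hbound n)
  have hfin : ENNReal.ofReal (∫ q, D q ∂P) ≠ ⊤ := ENNReal.ofReal_ne_top
  refine ENNReal.le_of_add_le_add_right hfin (le_trans (le_of_eq ?_) hfatou)
  rw [ofReal_integral_eq_lintegral_ofReal hDint (Eventually.of_forall hD0),
    ← lintegral_add_right' _ hDint.aemeasurable.ennreal_ofReal]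
  refine lintegral_congr_ae ?_
  filter_upwards [hae] with q ⟨hq, ht⟩
  refine (ENNReal.ofReal_add ?_ (hD0 q)).symm
  have h1 := morDen_nonneg (u := u) (g := g) hG0 hGf hl0 hq
  have h2 : 0 ≤ timeCutoff κ R (q.2 + ‖q.1‖) :=
    timeCutoff_nonneg (add_nonneg ht.1.le (norm_nonneg _))
  have h3 : 0 ≤ 2 * (1 - 2 * κ) := by linarith
  positivity

end Limits

section Coulomb

open scoped RealInnerProductSpace Topology

lemma aestronglyMeasurable_of_continuousAt_fst_ne {F Z : Type*} [NormedAddCommGroup F]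
    [MeasurableSpace F] [BorelSpace F] [SecondCountableTopology F] [TopologicalSpace Z]
    [TopologicalSpace.PseudoMetrizableSpace Z] {f : F × ℝ → Z} {μ : Measure F} {ν : Measure ℝ}
    [NullSingletonClass μ] [SFinite μ] [SFinite ν] (hf : ∀ q : F × ℝ, q.1 ≠ 0 → ContinuousAt f q) :
    AEStronglyMeasurable f (μ.prod ν) := by
  have h0 : IsOpen {q : F × ℝ | q.1 ≠ 0} := isOpen_compl_singleton.preimage continuous_fst
  have h1 : ∀ᵐ q ∂(μ.prod ν), q ∈ {q : F × ℝ | q.1 ≠ 0} :=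
    Measure.quasiMeasurePreserving_fst.ae (compl_mem_ae_iff.2 (measure_singleton (0 : F)))
  rw [← Measure.restrict_eq_self_of_ae_mem h1]
  exact ContinuousOn.aestronglyMeasurable (fun q hq => (hf q hq).continuousWithinAt)
    h0.measurableSet

/-- The power nonlinearity `ζ |y| ^ (p - 1) y`. -/
noncomputable def powerNonlinearity (p ζ y : ℝ) : ℝ := ζ * |y| ^ (p - 1) * y

/-- The primitive `ζ |y| ^ (p + 1) / (p + 1)` of `powerNonlinearity`. -/
noncomputable def powerPotential (p ζ y : ℝ) : ℝ := ζ * |y| ^ (p + 1) / (p + 1)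

variable {p ζ : ℝ}

lemma hasDerivAt_powerPotential (h : ζ = 0 ∨ 0 < ζ ∧ 1 < p) (y : ℝ) :
    HasDerivAt (powerPotential p ζ) (powerNonlinearity p ζ y) y := by
  rcases h with rfl | ⟨-, hp⟩
  · have : powerPotential p 0 = fun _ => 0 := by ext; simp [powerPotential]
    simpa [this, powerNonlinearity] using hasDerivAt_const y (0 : ℝ)
  · refine (((hasDerivAt_abs_rpow y (show 1 < p + 1 by linarith)).const_mul ζ).div_const
      (p + 1)).congr_deriv ?_
    have : p + 1 ≠ 0 := by linarith
    rw [powerNonlinearity, show p + 1 - 2 = p - 1 by ring]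
    field_simp

lemma continuous_powerNonlinearity (h : ζ = 0 ∨ 0 < ζ ∧ 1 < p) :
    Continuous (powerNonlinearity p ζ) := by
  rcases h with rfl | ⟨-, hp⟩
  · have : powerNonlinearity p 0 = fun _ => 0 := by ext; simp [powerNonlinearity]
    exact this ▸ continuous_const
  · exact (continuous_const.mul (continuous_abs.rpow_const fun _ => Or.inr (by linarith))).mul
      continuous_id

lemma contDiff_powerPotential (h : ζ = 0 ∨ 0 < ζ ∧ 1 < p) : ContDiff ℝ 1 (powerPotential p ζ) := by
  rw [contDiff_one_iff_deriv]
  refine ⟨fun y => (hasDerivAt_powerPotential h y).differentiableAt, ?_⟩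
  rw [funext fun y => (hasDerivAt_powerPotential h y).deriv]
  exact continuous_powerNonlinearity h

lemma powerPotential_nonneg (h : ζ = 0 ∨ 0 < ζ ∧ 1 < p) (y : ℝ) : 0 ≤ powerPotential p ζ y := by
  rcases h with rfl | ⟨hζ, hp⟩
  · simp [powerPotential]
  · have : 0 < p + 1 := by linarith
    unfold powerPotential
    positivity

lemma mul_powerNonlinearity_sub (h : ζ = 0 ∨ 0 < ζ ∧ 1 < p) (y : ℝ) :
    y * powerNonlinearity p ζ y - 2 * powerPotential p ζ y = (p - 1) * powerPotential p ζ y := by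
  rcases h with rfl | ⟨-, hp⟩
  · simp [powerPotential, powerNonlinearity]
  · have h1 : |y| ^ (p + 1) = |y| ^ (p - 1) * y ^ 2 := by
      rcases eq_or_ne y 0 with rfl | hy
      · simp [Real.zero_rpow (show p + 1 ≠ 0 by linarith)]
      · rw [← sq_abs, ← Real.rpow_natCast |y| 2, ← Real.rpow_add (abs_pos.2 hy)]
        congr 1
        push_cast
        ring
    have : p + 1 ≠ 0 := by linarith
    rw [powerPotential, powerNonlinearity, h1]
    field_simp
    ring

variable {d : ℕ} {u : EuclideanSpace ℝ (Fin d) → ℝ → ℝ}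

lemma norm_angGrad_sq {v : EuclideanSpace ℝ (Fin d) → ℝ} {x : EuclideanSpace ℝ (Fin d)}
    (hx : x ≠ 0) : ‖angGrad v x‖ ^ 2 = ‖gradient v x‖ ^ 2 - rderiv v x ^ 2 := by
  have h : ⟪gradient v x, ‖x‖⁻¹ • x⟫ = rderiv v x := real_inner_comm _ _
  have h1 : ‖‖x‖⁻¹ • x‖ = 1 := norm_radDir hx
  rw [angGrad, norm_sub_sq_real, real_inner_smul_right, h, norm_smul, h1, Real.norm_eq_abs,
    mul_one, sq_abs]
  ring

lemma ePrime_eq_tangDen {x : EuclideanSpace ℝ (Fin d)} (hx : x ≠ 0) (t : ℝ) :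
    ePrime p ζ u x t = tangDen (lam d) (powerPotential p ζ) (fun q => u q.1 q.2)
      (fun q => gradient (fun y => u y q.2) q.1) (x, t) := by
  rw [ePrime, norm_angGrad_sq hx]
  rfl

lemma eMinus_eq {x : EuclideanSpace ℝ (Fin d)} (hx : x ≠ 0) (t : ℝ) :
    2 * eMinus p ζ u x t = 1 / 2 * outDer (((d : ℝ) - 1) / 2) (fun q => u q.1 q.2)
      (fun q => deriv (u q.1) q.2) (fun q => gradient (fun y => u y q.2) q.1) (x, t) ^ 2
      + tangDen (lam d) (powerPotential p ζ) (fun q => u q.1 q.2)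
        (fun q => gradient (fun y => u y q.2) q.1) (x, t) := by
  rw [eMinus, ePrime_eq_tangDen hx]
  have h : Lplus u x t = outDer (((d : ℝ) - 1) / 2) (fun q => u q.1 q.2)
      (fun q => deriv (u q.1) q.2) (fun q => gradient (fun y => u y q.2) q.1) (x, t) := rfl
  rw [h]
  ring

lemma Mden_eq_morDen (h : ζ = 0 ∨ 0 < ζ ∧ 1 < p) {x : EuclideanSpace ℝ (Fin d)} (hx : x ≠ 0)
    (t : ℝ) : Mden p ζ u x t = morDen (lam d) (((d : ℝ) - 1) / 2) (powerNonlinearity p ζ)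
      (powerPotential p ζ) (fun q => u q.1 q.2) (fun q => gradient (fun y => u y q.2) q.1)
      (x, t) := by
  have hr : ‖x‖ ≠ 0 := norm_ne_zero_iff.2 hx
  rw [Mden, norm_angGrad_sq hx, morDen, mul_powerNonlinearity_sub h]
  have h1 : ζ * ((d : ℝ) - 1) * (p - 1) * |u x t| ^ (p + 1) / (4 * (p + 1) * ‖x‖)
      = ((d : ℝ) - 1) / 2 / 2 * ((p - 1) * powerPotential p ζ (u x t)) / ‖x‖ := by
    rcases h with rfl | ⟨-, hp⟩
    · simp [powerPotential]
    · have : p + 1 ≠ 0 := by linarith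
      rw [powerPotential]
      field_simp
      ring
  rw [h1]
  rfl

end Coulomb

section Global

open scoped RealInnerProductSpace Topology

lemma lintegral_prod_restrict_Ioi {F : Type*} [MeasurableSpace F] {μ : Measure F} {ν : Measure ℝ}
    [SFinite μ] [SFinite ν] {f : F × ℝ → ENNReal} {R : ℝ} (hf : ∀ q : F × ℝ, R < q.2 → f q = 0) :
    ∫⁻ q, f q ∂(μ.prod (ν.restrict (Set.Ioi 0))) = ∫⁻ q, f q ∂(μ.prod (ν.restrict (Set.Ioc 0 R))) := by
  have h : μ.prod (ν.restrict (Set.Ioc 0 R))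
      = (μ.prod (ν.restrict (Set.Ioi 0))).restrict (Set.univ ×ˢ Set.Iic R) := by
    rw [← Measure.prod_restrict, Measure.restrict_univ, Measure.restrict_restrict measurableSet_Iic,
      Set.inter_comm, Set.Ioi_inter_Iic]
  rw [h, ← lintegral_indicator (MeasurableSet.univ.prod measurableSet_Iic)]
  refine lintegral_congr fun q => ?_
  by_cases hq : q.2 ≤ R
  · rw [Set.indicator_of_mem (by simpa using hq)]
  · rw [Set.indicator_of_notMem (by simpa using hq), hf q (not_le.1 hq)]

lemma measurable_timeCutoff (κ R : ℝ) : Measurable (timeCutoff κ R) := by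
  unfold timeCutoff
  fun_prop

variable {d : ℕ} {u w a : EuclideanSpace ℝ (Fin d) × ℝ → ℝ}
  {g k : EuclideanSpace ℝ (Fin d) × ℝ → EuclideanSpace ℝ (Fin d)}
  {H : EuclideanSpace ℝ (Fin d) × ℝ → EuclideanSpace ℝ (Fin d) →L[ℝ] EuclideanSpace ℝ (Fin d)}
  {f G : ℝ → ℝ} {l c κ K : ℝ}

lemma IsWaveJet.continuousAt_morDen (J : IsWaveJet u w a g k H) (hG : Continuous G)
    (hf : Continuous f) {q : EuclideanSpace ℝ (Fin d) × ℝ} (hq : q.1 ≠ 0) :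
    ContinuousAt (morDen l c f G u g) q := by
  have hr : ‖q.1‖ ≠ 0 := norm_ne_zero_iff.2 hq
  have cu := (J.contDiffAt_u q hq).continuousAt
  have cg := (J.contDiffAt_g q hq).continuousAt
  have cs := ((J.contDiffAt_g q hq).radPart hq).continuousAt
  have cn : ContinuousAt (fun q : EuclideanSpace ℝ (Fin d) × ℝ => ‖q.1‖) q :=
    continuousAt_fst.norm
  exact ((((continuousAt_const.mul ((cg.norm.pow 2).sub (cs.pow 2))).div
    cn hr).add ((continuousAt_const.mul (cu.pow 2)).div (cn.pow 3) (pow_ne_zero _ hr))).add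
    ((continuousAt_const.mul ((cu.mul (hf.continuousAt.comp cu)).sub
      (continuousAt_const.mul (hG.continuousAt.comp cu)))).div cn hr)).add
    ((cu.pow 2).div (continuousAt_const.mul (cn.pow 2)) (by simpa using hq))

lemma IsWaveJet.lintegral_rpow_mul_morDen_le (J : IsWaveJet u w a g k H) (hd : d ≠ 0)
    (hG : Continuous G) (hf : Continuous f)
    (hK : ∀ n : ℕ, ∫⁻ q, ENNReal.ofReal (2 * (1 - 2 * κ) *
      (timeCutoff κ ((n : ℝ) + 1) (q.2 + ‖q.1‖) * morDen l c f G u g q))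
        ∂(volume.prod (volume.restrict (Set.Ioc 0 ((n : ℝ) + 1)))) ≤ ENNReal.ofReal K) :
    ∫⁻ q, ENNReal.ofReal (2 * (1 - 2 * κ) * ((q.2 + ‖q.1‖) ^ κ * morDen l c f G u g q))
      ∂(volume.prod (volume.restrict (Set.Ioi 0))) ≤ ENNReal.ofReal K := by
  have hne : Nonempty (Fin d) := ⟨⟨0, by omega⟩⟩
  have hM : AEStronglyMeasurable (morDen l c f G u g)
      ((volume : Measure (EuclideanSpace ℝ (Fin d))).prod
        (volume.restrict (Set.Ioi (0 : ℝ)))) :=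
    aestronglyMeasurable_of_continuousAt_fst_ne fun q hq => J.continuousAt_morDen hG hf hq
  set F : ℕ → EuclideanSpace ℝ (Fin d) × ℝ → ENNReal := fun n q => ENNReal.ofReal
    (2 * (1 - 2 * κ) * (timeCutoff κ ((n : ℝ) + 1) (q.2 + ‖q.1‖) * morDen l c f G u g q)) with hF
  have hFm : ∀ n, AEMeasurable (F n) (volume.prod (volume.restrict (Set.Ioi 0))) := fun n =>
    ((((measurable_timeCutoff κ ((n : ℝ) + 1)).comp
      (measurable_snd.add measurable_fst.norm)).aemeasurable.mul hM.aemeasurable).const_mul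
        _).ennreal_ofReal
  have hFK : ∀ n, ∫⁻ q, F n q ∂(volume.prod (volume.restrict (Set.Ioi 0))) ≤ ENNReal.ofReal K := by
    refine fun n => (lintegral_prod_restrict_Ioi (R := (n : ℝ) + 1) fun q hq => ?_).trans_le (hK n)
    have h0 := norm_nonneg q.1
    simp [hF, timeCutoff_eq_zero (κ := κ) (show 0 < (n : ℝ) + 1 by positivity)
      (show (n : ℝ) + 1 ≤ q.2 + ‖q.1‖ by linarith)]
  calc _ = ∫⁻ q, liminf (fun n => F n q) atTop ∂(volume.prod (volume.restrict (Set.Ioi 0))) := by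
        refine lintegral_congr fun q => ?_
        exact (((ENNReal.continuous_ofReal.tendsto _).comp (((tendsto_timeCutoff κ
          (q.2 + ‖q.1‖)).mul_const (morDen l c f G u g q)).const_mul
            (2 * (1 - 2 * κ)))).liminf_eq).symm
    _ ≤ liminf (fun n => ∫⁻ q, F n q ∂(volume.prod (volume.restrict (Set.Ioi 0)))) atTop :=
        lintegral_liminf_le' hFm
    _ ≤ ENNReal.ofReal K := by
        refine (liminf_le_liminf (Eventually.of_forall hFK)).trans ?_
        rw [liminf_const]

end Global

section CoulombSolution

open scoped RealInnerProductSpace Topology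

variable {d : ℕ} {p ζ E : ℝ} {u : EuclideanSpace ℝ (Fin d) → ℝ → ℝ}

lemma half_norm_gradient_sq_le_eDen (h : ζ = 0 ∨ 0 < ζ ∧ 1 < p) (x : EuclideanSpace ℝ (Fin d)) (t : ℝ) :
    1 / 2 * ‖gradient (fun y => u y t) x‖ ^ 2 ≤ eDen p ζ u x t := by
  have h1 := powerPotential_nonneg h (u x t)
  have h2 : 0 ≤ (u x t) ^ 2 / (2 * ‖x‖) := by positivity
  have h3 := sq_nonneg (deriv (u x) t)
  rw [powerPotential] at h1
  rw [eDen]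
  linarith

lemma IsCoulombSolution.integrable_gradient_sq (hu : IsCoulombSolution p ζ u E) (hd : d ≠ 0)
    (h : ζ = 0 ∨ 0 < ζ ∧ 1 < p) (ν : Measure ℝ) [IsFiniteMeasure ν] :
    Integrable (fun q : EuclideanSpace ℝ (Fin d) × ℝ => ‖gradient (fun y => u y q.2) q.1‖ ^ 2)
      (volume.prod ν) := by
  have hne : Nonempty (Fin d) := ⟨⟨0, by omega⟩⟩
  obtain ⟨a, k, H, J⟩ := exists_isWaveJet_of_contDiffOn hu.2.1
  have h0 : ∀ (x : EuclideanSpace ℝ (Fin d)) t, 0 ≤ eDen p ζ u x t := fun x t =>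
    (by positivity : (0 : ℝ) ≤ _).trans (half_norm_gradient_sq_le_eDen h x t)
  have hm : AEStronglyMeasurable (fun q : EuclideanSpace ℝ (Fin d) × ℝ => eDen p ζ u q.1 q.2)
      (volume.prod ν) := by
    refine aestronglyMeasurable_of_continuousAt_fst_ne fun q hq => ?_
    have cu := (J.contDiffAt_u q hq).continuousAt
    exact (((continuousAt_const.mul ((J.contDiffAt_g q hq).continuousAt.norm.pow 2)).add
      (continuousAt_const.mul ((J.contDiffAt_w q hq).continuousAt.pow 2))).add
      ((cu.pow 2).div (continuousAt_const.mul continuousAt_fst.norm) (by simpa using hq))).add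
      ((contDiff_powerPotential h).continuous.continuousAt.comp cu)
  have hi : Integrable (fun q : EuclideanSpace ℝ (Fin d) × ℝ => eDen p ζ u q.1 q.2)
      (volume.prod ν) := by
    refine (integrable_prod_iff' hm).2 ⟨Eventually.of_forall fun t => hu.2.2.2.1 t, ?_⟩
    have : (fun t => ∫ x : EuclideanSpace ℝ (Fin d), ‖eDen p ζ u x t‖) = fun _ => E := by
      ext t
      simp_rw [Real.norm_of_nonneg (h0 _ t)]
      exact hu.2.2.2.2 t
    rw [this]
    exact integrable_const E
  refine (hi.const_mul 2).mono' (aestronglyMeasurable_of_continuousAt_fst_ne fun q hq =>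
    (J.contDiffAt_g q hq).continuousAt.norm.pow 2) (Eventually.of_forall fun q => ?_)
  rw [Real.norm_of_nonneg (by positivity)]
  linarith [half_norm_gradient_sq_le_eDen (u := u) h q.1 q.2]

lemma powerPotential_le_mul_sub (h : ζ = 0 ∨ 0 < ζ ∧ 1 < p) {c : ℝ} (hc : 0 < ζ → 1 ≤ c * (p - 1))
    (y : ℝ) : powerPotential p ζ y ≤
      c * (y * powerNonlinearity p ζ y - 2 * powerPotential p ζ y) := by
  rw [mul_powerNonlinearity_sub h, ← mul_assoc]
  rcases h with rfl | h
  · simp [powerPotential]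
  · exact le_mul_of_one_le_left (powerPotential_nonneg (Or.inr h) y) (hc h.1)

lemma IsCoulombSolution.lintegral_morDen_le (hu : IsCoulombSolution p ζ u E) (hd : 4 ≤ d)
    (h : ζ = 0 ∨ 0 < ζ ∧ 1 < p) (hp : 0 < ζ → 1 ≤ ((d : ℝ) - 1) / 2 * (p - 1)) {κ : ℝ}
    (hκ0 : 0 < κ) (hκ1 : κ < 1 / 2)
    (hInt : Integrable (fun x : EuclideanSpace ℝ (Fin d) => ‖x‖ ^ κ * eMinus p ζ u x 0)) :
    ∫⁻ t in Set.Ioi (0 : ℝ), ∫⁻ x : EuclideanSpace ℝ (Fin d),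
        ENNReal.ofReal (2 * (1 - 2 * κ) * ((t + ‖x‖) ^ κ * Mden p ζ u x t))
      ≤ ENNReal.ofReal (2 * ∫ x : EuclideanSpace ℝ (Fin d), ‖x‖ ^ κ * eMinus p ζ u x 0) := by
  have hne : Nonempty (Fin d) := ⟨⟨0, by omega⟩⟩
  have hd' : (4 : ℝ) ≤ d := by exact_mod_cast hd
  have hae : ∀ᵐ x : EuclideanSpace ℝ (Fin d), x ≠ 0 := compl_mem_ae_iff.2 (measure_singleton _)
  obtain ⟨a, k, H, J⟩ := exists_isWaveJet_of_contDiffOn hu.2.1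
  have hl0 : 0 ≤ lam d := by
    unfold lam
    exact div_nonneg (mul_nonneg (by linarith) (by linarith)) (by norm_num)
  have hGf := powerPotential_le_mul_sub h hp
  have hf := continuous_powerNonlinearity h
  have hG := contDiff_powerPotential h
  have heq : (fun x : EuclideanSpace ℝ (Fin d) => 2 * (‖x‖ ^ κ * eMinus p ζ u x 0)) =ᵐ[volume]
      fun x => ‖x‖ ^ κ * (1 / 2 * outDer (((d : ℝ) - 1) / 2) (fun q => u q.1 q.2)
        (fun q => deriv (u q.1) q.2) (fun q => gradient (fun y => u y q.2) q.1) (x, 0) ^ 2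
        + tangDen (lam d) (powerPotential p ζ) (fun q => u q.1 q.2)
          (fun q => gradient (fun y => u y q.2) q.1) (x, 0)) := by
    filter_upwards [hae] with x hx
    rw [← eMinus_eq hx]
    ring
  have key := J.lintegral_rpow_mul_morDen_le (κ := κ) (l := lam d) (c := ((d : ℝ) - 1) / 2)
    (K := 2 * ∫ x : EuclideanSpace ℝ (Fin d), ‖x‖ ^ κ * eMinus p ζ u x 0) (by omega) hG.continuous hf
    fun n => by
      rw [← integral_const_mul, integral_congr_ae heq]
      refine J.lintegral_timeCutoff_mul_morDen_le hd hu.1 hG (hasDerivAt_powerPotential h) hf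
        (powerPotential_nonneg h) hGf hl0 hκ0 hκ1 (by positivity) (by ring)
        (by rw [lam]; ring) (fun q hq => ?_)
        (hu.integrable_gradient_sq (by omega) h _) ((hInt.const_mul 2).congr heq)
      rw [← J.deriv_deriv hq, ← J.lap_eq hq]
      exact hu.2.2.1 q.1 hq q.2
  rw [lintegral_prod_symm _ ?_] at key
  · refine le_trans (le_of_eq ?_) key
    refine lintegral_congr fun t => lintegral_congr_ae ?_
    filter_upwards [hae] with x hx
    rw [Mden_eq_morDen h hx]
  · exact (((measurable_snd.add measurable_fst.norm).pow_const κ).aemeasurable.mul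
      (aestronglyMeasurable_of_continuousAt_fst_ne fun q hq =>
        J.continuousAt_morDen hG.continuous hf hq).aemeasurable).const_mul _ |>.ennreal_ofReal

end CoulombSolution

/-- Weighted global Morawetz estimate: for `κ ∈ (0,1/2)` and
a classical finite-energy solution in dimension `d ≥ 4` with
`∫ |x|^κ e₋(x,0) dx = K < ∞`,
`∫_0^∞ ∫ (t+|x|)^κ M(x,t) dx dt ≤ (1-2κ)⁻¹ K`. -/
theorem stmt17 (d : ℕ) (hd : 4 ≤ d) (p ζ : ℝ) (hζ : ζ = 0 ∨ ζ = 1)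
    (hζ1 : ζ = 1 →
      d ≤ 5 ∧ 1 + 4 / ((d : ℝ) - 1) ≤ p ∧ p ≤ 1 + 4 / ((d : ℝ) - 2))
    (κ : ℝ) (hκ0 : 0 < κ) (hκ1 : κ < 1 / 2)
    (u : EuclideanSpace ℝ (Fin d) → ℝ → ℝ) (E : ℝ)
    (hu : IsCoulombSolution p ζ u E)
    (K : ℝ)
    (hKint : Integrable (fun x : EuclideanSpace ℝ (Fin d) =>
      ‖x‖ ^ κ * eMinus p ζ u x 0))
    (hK : K = ∫ x : EuclideanSpace ℝ (Fin d), ‖x‖ ^ κ * eMinus p ζ u x 0) :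
    ∫⁻ t in Set.Ioi (0 : ℝ), ∫⁻ x : EuclideanSpace ℝ (Fin d),
        ENNReal.ofReal ((t + ‖x‖) ^ κ * Mden p ζ u x t)
      ≤ ENNReal.ofReal ((1 - 2 * κ)⁻¹ * K) := by

  have hd' : (4 : ℝ) ≤ d := by exact_mod_cast hd
  have hp : 0 < ζ → 1 + 4 / ((d : ℝ) - 1) ≤ p := fun h => by
    rcases hζ with rfl | rfl
    · exact absurd h (lt_irrefl _)
    · exact (hζ1 rfl).2.1
  have h4 : 0 < 4 / ((d : ℝ) - 1) := div_pos (by norm_num) (by linarith)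
  have h : ζ = 0 ∨ 0 < ζ ∧ 1 < p := by
    rcases hζ with rfl | rfl
    · exact Or.inl rfl
    · exact Or.inr ⟨one_pos, by linarith [hp one_pos]⟩
  have hc : 0 < ζ → 1 ≤ ((d : ℝ) - 1) / 2 * (p - 1) := fun h => by
    have h1 : 4 / ((d : ℝ) - 1) ≤ p - 1 := by linarith [hp h]
    rw [div_le_iff₀ (by linarith)] at h1
    linarith
  have hκ : 0 < 2 * (1 - 2 * κ) := by linarith
  have key := mul_le_mul_right (hu.lintegral_morDen_le hd h hc hκ0 hκ1 hKint)
    (ENNReal.ofReal (2 * (1 - 2 * κ))⁻¹)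
  rw [← ENNReal.ofReal_mul (by positivity), ← hK, ← lintegral_const_mul' _ _ ENNReal.ofReal_ne_top]
    at key
  refine (le_of_eq ?_).trans (key.trans (le_of_eq ?_))
  · refine lintegral_congr fun t => ?_
    rw [← lintegral_const_mul' _ _ ENNReal.ofReal_ne_top]
    refine lintegral_congr fun x => ?_
    rw [← ENNReal.ofReal_mul (by positivity), inv_mul_cancel_left₀ hκ.ne']
  · rw [mul_inv]
    congr 1
    ring
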